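/- arXiv:1911.07282 — 2 statements merged into one kernel-verified Lean document; each statement's English description precedes it below -/
import Mathlib

section
/- Fix an integer n ≥ 2 and constants 0 ≤ t̄ < T < ∞. Let x₀ : [0, t̄] → ℝ and let u(x,t) be smooth and positive for x > x₀(t), t ∈ [0, t̄], with u(x₀(t), t) = 0, u_x > 0, u_xx < 0, solving u_t = u_xx/(1+u_x²) − (n−1)/u, with uniformly bounded second fundamental form on [0, t̄], and such that ℜ := −u·u_xx/(1+u_x²) extends continuously with value 1 at the tip x = x₀(t). If ℜ ≤ 1 at t = 0, then for every t ∈ [0, t̄] one has ℜ ≤ 1, and the maximum curvature sup_{Γ_t}|h| occurs at the tip of the hypersurface Γ_t; in particular, ℜ ≤ 1 implies 1 + u_x² + u·u_xx ≥ 0, so that ∂_x(1/κ₁) = u_x(1+u_x²)^{−1/2}(1 + u_x² + u·u_xx) ≥ 0 and each principal curvature achieves its maximum at the tip. -/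
open Filter Topology Set

/-- Spatial derivative `u_x` of a profile function `u(x,t)`. -/
noncomputable def uX (u : ℝ → ℝ → ℝ) (x t : ℝ) : ℝ := deriv (fun x' => u x' t) x

/-- Second spatial derivative `u_xx`. -/
noncomputable def uXX (u : ℝ → ℝ → ℝ) (x t : ℝ) : ℝ := deriv (deriv (fun x' => u x' t)) x

/-- Time derivative `u_t`. -/
noncomputable def uT (u : ℝ → ℝ → ℝ) (x t : ℝ) : ℝ := deriv (fun t' => u x t') t

/-- The curvature ratio `ℜ = κ_n/κ₁ = −u·u_xx/(1+u_x²)`. -/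
noncomputable def ratioR (u : ℝ → ℝ → ℝ) (x t : ℝ) : ℝ :=
  -(u x t) * uXX u x t / (1 + (uX u x t) ^ 2)

/-- The rotational principal curvature `κ₁ = 1/(u√(1+u_x²))`. -/
noncomputable def kappa1 (u : ℝ → ℝ → ℝ) (x t : ℝ) : ℝ :=
  1 / (u x t * Real.sqrt (1 + (uX u x t) ^ 2))

/-- The graphical principal curvature `κ_n = −u_xx/(1+u_x²)^{3/2}`. -/
noncomputable def kappaN (u : ℝ → ℝ → ℝ) (x t : ℝ) : ℝ :=
  -uXX u x t / (1 + (uX u x t) ^ 2) ^ ((3 : ℝ) / 2)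

/-- The space-time region swept out by the profile curves. -/
def profileDomain (tb : ℝ) (x₀ : ℝ → ℝ) : Set (ℝ × ℝ) :=
  {p : ℝ × ℝ | p.2 ∈ Icc 0 tb ∧ x₀ p.2 < p.1}

/-- A convex rotational mean curvature flow on `[0, tb]` with tip `x₀` and principal curvatures
bounded by `K`. -/
structure ProfileFlow (n : ℕ) (tb K : ℝ) (x₀ : ℝ → ℝ) (u : ℝ → ℝ → ℝ) : Prop where
  two_le : 2 ≤ n
  smooth : ContDiffOn ℝ (⊤ : ℕ∞) (Function.uncurry u) (profileDomain tb x₀)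
  pos : ∀ x t : ℝ, t ∈ Icc 0 tb → x₀ t < x → 0 < u x t
  tip : ∀ t ∈ Icc 0 tb, Tendsto (fun x => u x t) (𝓝[>] (x₀ t)) (𝓝 0)
  ux_pos : ∀ x t : ℝ, t ∈ Icc 0 tb → x₀ t < x → 0 < uX u x t
  uxx_neg : ∀ x t : ℝ, t ∈ Icc 0 tb → x₀ t < x → uXX u x t < 0
  pde : ∀ x t : ℝ, t ∈ Icc 0 tb → x₀ t < x →
    uT u x t = uXX u x t / (1 + (uX u x t) ^ 2) - ((n : ℝ) - 1) / u x t
  kappa1_le : ∀ x t : ℝ, t ∈ Icc 0 tb → x₀ t < x → kappa1 u x t ≤ K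
  kappaN_le : ∀ x t : ℝ, t ∈ Icc 0 tb → x₀ t < x → kappaN u x t ≤ K

lemma hasDerivAt_div_sqrt_one_add_sq (a : ℝ) :
    HasDerivAt (fun a : ℝ => a / √(1 + a ^ 2)) (1 / √(1 + a ^ 2) ^ 3) a := by
  have h0 : 0 < 1 + a ^ 2 := by positivity
  have h1 : HasDerivAt (fun a : ℝ => 1 + a ^ 2) (2 * a) a := by
    simpa using (hasDerivAt_pow 2 a).const_add 1
  have hs : √(1 + a ^ 2) ≠ 0 := (Real.sqrt_pos.2 h0).ne'
  have hq : √(1 + a ^ 2) ^ 2 = 1 + a ^ 2 := Real.sq_sqrt h0.le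
  refine ((hasDerivAt_id a).div (h1.sqrt h0.ne') hs).congr_deriv ?_
  simp only [id]
  field_simp
  rw [hq]; ring

lemma strictMono_div_sqrt_one_add_sq : StrictMono (fun a : ℝ => a / √(1 + a ^ 2)) := by
  refine strictMono_of_deriv_pos fun a => ?_
  rw [(hasDerivAt_div_sqrt_one_add_sq a).deriv]
  positivity

lemma div_sqrt_one_add_sq_lt_one (a : ℝ) : a / √(1 + a ^ 2) < 1 := by
  rw [div_lt_one (by positivity)]
  exact Real.lt_sqrt_of_sq_lt (by linarith)

lemma one_add_sq_rpow_three_half (a : ℝ) :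
    (1 + a ^ 2) ^ ((3 : ℝ) / 2) = √(1 + a ^ 2) ^ 3 := by
  rw [Real.sqrt_eq_rpow, ← Real.rpow_natCast ((1 + a ^ 2) ^ ((1 : ℝ) / 2)) 3,
    ← Real.rpow_mul (by positivity)]
  norm_num

lemma kappaN_eq (u : ℝ → ℝ → ℝ) (x t : ℝ) :
    kappaN u x t = -uXX u x t / √(1 + (uX u x t) ^ 2) ^ 3 := by
  rw [kappaN, one_add_sq_rpow_three_half]

/-- The curvature gap `κ_n - κ₁`. -/
noncomputable def curvatureGap (u : ℝ → ℝ → ℝ) (x t : ℝ) : ℝ := kappaN u x t - kappa1 u x t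

lemma curvatureGap_eq (u : ℝ → ℝ → ℝ) (x t : ℝ) :
    curvatureGap u x t =
      -uXX u x t / √(1 + uX u x t ^ 2) ^ 3 - 1 / (u x t * √(1 + uX u x t ^ 2)) := by
  rw [curvatureGap, kappaN_eq, kappa1]

lemma ratioR_le_one_iff (u : ℝ → ℝ → ℝ) (x t : ℝ) :
    ratioR u x t ≤ 1 ↔ 0 ≤ 1 + uX u x t ^ 2 + u x t * uXX u x t := by
  rw [ratioR, div_le_one (by positivity)]
  constructor <;> intro _ <;> linarith

/-- A barrier which is proper on the space-time region. -/
noncomputable def barrier (u : ℝ → ℝ → ℝ) (x t : ℝ) : ℝ := 1 / u x t + x ^ 2 + 1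

/-- The time-weighted curvature gap, pushed down by a multiple of the barrier. -/
noncomputable def penalizedGap (u : ℝ → ℝ → ℝ) (lam ε x t : ℝ) : ℝ :=
  Real.exp (-lam * t) * curvatureGap u x t - ε * barrier u x t

section calculus

variable {a b c : ℝ → ℝ} {a' b' c' x : ℝ} {s : Set ℝ}

lemma hasDerivWithinAt_sqrt_one_add_sq (hb : HasDerivWithinAt b b' s x) :
    HasDerivWithinAt (fun y => √(1 + b y ^ 2)) (b x * b' / √(1 + b x ^ 2)) s x := by
  refine (((hb.pow 2).const_add 1).sqrt (by simp only [Pi.pow_apply]; positivity)).congr_deriv ?_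
  have : √(1 + b x ^ 2) ≠ 0 := by positivity
  simp only [Pi.pow_apply]
  field_simp
  push_cast
  ring

/-- Derivative of the curvature gap `κ_n - κ₁`, written in terms of the first two jets. -/
lemma hasDerivWithinAt_gap (ha : HasDerivWithinAt a a' s x) (hb : HasDerivWithinAt b b' s x)
    (hc : HasDerivWithinAt c c' s x) (h0 : a x ≠ 0) :
    HasDerivWithinAt
      (fun y => -c y / √(1 + b y ^ 2) ^ 3 - 1 / (a y * √(1 + b y ^ 2)))
      (-c' / √(1 + b x ^ 2) ^ 3 + 3 * c x * b x * b' / √(1 + b x ^ 2) ^ 5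
        + a' / (a x ^ 2 * √(1 + b x ^ 2)) + b x * b' / (a x * √(1 + b x ^ 2) ^ 3)) s x := by
  have hV : √(1 + b x ^ 2) ≠ 0 := by positivity
  have hd := hasDerivWithinAt_sqrt_one_add_sq hb
  refine ((hc.neg.div (hd.pow 3) (pow_ne_zero 3 hV)).sub
    ((hasDerivWithinAt_const x s 1).div (ha.mul hd) (mul_ne_zero h0 hV))).congr_deriv ?_
  simp only [Pi.pow_apply, Pi.neg_apply, Pi.mul_apply]
  field_simp
  ring

lemma hasDerivAt_gap_deriv {r : ℝ → ℝ} {w : ℝ} (ha : HasDerivAt a (b x) x)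
    (hb : HasDerivAt b (c x) x) (hc : HasDerivAt c (r x) x) (hr : HasDerivAt r w x)
    (h0 : a x ≠ 0) {V : ℝ} (hV : V = √(1 + b x ^ 2)) :
    HasDerivAt (fun y => -r y / √(1 + b y ^ 2) ^ 3 + 3 * c y * b y * c y / √(1 + b y ^ 2) ^ 5
        + b y / (a y ^ 2 * √(1 + b y ^ 2)) + b y * c y / (a y * √(1 + b y ^ 2) ^ 3))
      (-w / V ^ 3 + 3 * b x * c x * r x / V ^ 5
        + 3 * (c x ^ 3 + 2 * b x * c x * r x) / V ^ 5 - 15 * b x ^ 2 * c x ^ 3 / V ^ 7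
        + c x / (a x ^ 2 * V) - 2 * b x ^ 2 / (a x ^ 3 * V) - 2 * b x ^ 2 * c x / (a x ^ 2 * V ^ 3)
        + (c x ^ 2 + b x * r x) / (a x * V ^ 3) - 3 * b x ^ 2 * c x ^ 2 / (a x * V ^ 5)) x := by
  have hV0 : √(1 + b x ^ 2) ≠ 0 := by positivity
  have hd := (hasDerivWithinAt_sqrt_one_add_sq hb.hasDerivWithinAt (s := univ)).hasDerivAt univ_mem
  refine ((((hr.neg.div (hd.pow 3) (pow_ne_zero 3 hV0)).add
    ((((hc.const_mul 3).mul hb).mul hc).div (hd.pow 5) (pow_ne_zero 5 hV0))).add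
    (hb.div ((ha.pow 2).mul hd) (mul_ne_zero (pow_ne_zero 2 h0) hV0))).add
    ((hb.mul hc).div (ha.mul (hd.pow 3)) (mul_ne_zero h0 (pow_ne_zero 3 hV0)))).congr_deriv ?_
  simp only [Pi.pow_apply, Pi.neg_apply, Pi.mul_apply]
  rw [hV]
  field_simp
  ring

lemma nonpos_of_isLocalMax {f f₁ : ℝ → ℝ} (h : IsLocalMax f x)
    (hf : ∀ᶠ y in 𝓝 x, HasDerivAt f (f₁ y) y) {m : ℝ} (hf₁ : HasDerivAt f₁ m x) : m ≤ 0 := by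
  by_contra! hm
  have hd : deriv f =ᶠ[𝓝 x] f₁ := hf.mono fun y hy => hy.deriv
  have hdd : deriv (deriv f) x = m := hd.deriv_eq.trans hf₁.deriv
  have hmin := isLocalMin_of_deriv_deriv_pos (hdd ▸ hm) h.deriv_eq_zero hf.self_of_nhds.continuousAt
  have hc : f =ᶠ[𝓝 x] fun _ => f x := by
    filter_upwards [h, hmin] with y h1 h2 using le_antisymm h1 h2
  have h0 : deriv (deriv f) x = 0 := by
    rw [hc.deriv.deriv_eq]; simp
  exact hm.ne' (hdd.symm.trans h0)

lemma nonneg_of_isMaxOn_Icc {f : ℝ → ℝ} {m t tb : ℝ} (h : IsLocalMaxOn f (Icc 0 tb) t)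
    (hf : HasDerivWithinAt f m (Icc 0 tb) t) (ht : t ∈ Icc 0 tb) (h0 : t ≠ 0) : 0 ≤ m := by
  have h1 := h.hasFDerivWithinAt_nonpos hf.hasFDerivWithinAt
    (sub_mem_posTangentConeAt_of_segment_subset ((convex_Icc 0 tb).segment_subset ht
      ⟨le_rfl, ht.1.trans ht.2⟩))
  have h2 : 0 < t := ht.1.lt_of_ne' h0
  simp at h1
  nlinarith

lemma gap_evolution {n u p q r w V : ℝ} (hV : 0 < V) (hu : 0 < u) (h : V ^ 2 = 1 + p ^ 2) :
    -(w / (1 + p ^ 2) - 2 * p * q * r / (1 + p ^ 2) ^ 2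
        - 2 * (q ^ 3 + 2 * p * q * r) / (1 + p ^ 2) ^ 2 + 8 * p ^ 2 * q ^ 3 / (1 + p ^ 2) ^ 3
        + (n - 1) * q / u ^ 2 - 2 * (n - 1) * p ^ 2 / u ^ 3) / V ^ 3
      + 3 * q * p * (r / (1 + p ^ 2) - 2 * p * q ^ 2 / (1 + p ^ 2) ^ 2 + (n - 1) * p / u ^ 2)
        / V ^ 5
      + (q / (1 + p ^ 2) - (n - 1) / u) / (u ^ 2 * V)
      + p * (r / (1 + p ^ 2) - 2 * p * q ^ 2 / (1 + p ^ 2) ^ 2 + (n - 1) * p / u ^ 2)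
        / (u * V ^ 3) =
    (-w / V ^ 3 + 3 * p * q * r / V ^ 5
        + 3 * (q ^ 3 + 2 * p * q * r) / V ^ 5 - 15 * p ^ 2 * q ^ 3 / V ^ 7
        + q / (u ^ 2 * V) - 2 * p ^ 2 / (u ^ 3 * V) - 2 * p ^ 2 * q / (u ^ 2 * V ^ 3)
        + (q ^ 2 + p * r) / (u * V ^ 3) - 3 * p ^ 2 * q ^ 2 / (u * V ^ 5)) / (1 + p ^ 2)
      + ((n - 1) * (1 / (u * V)) ^ 2 + (-q / V ^ 3) ^ 2 - 2 * n * p ^ 2 / (u ^ 2 * (1 + p ^ 2)))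
        * (-q / V ^ 3 - 1 / (u * V)) := by
  rw [← h]
  field_simp
  grind

end calculus

namespace ProfileFlow

variable {n : ℕ} {tb K : ℝ} {x₀ : ℝ → ℝ} {u : ℝ → ℝ → ℝ}

lemma contDiffOn_slice (h : ProfileFlow n tb K x₀ u) {t : ℝ} (ht : t ∈ Icc 0 tb) :
    ContDiffOn ℝ (⊤ : ℕ∞) (fun x => u x t) (Ioi (x₀ t)) :=
  h.smooth.comp (g := Function.uncurry u) (f := fun x : ℝ => (x, t))
    (by fun_prop) (fun _ hx => ⟨ht, hx⟩)

lemma hasDerivAt_u (h : ProfileFlow n tb K x₀ u) {x t : ℝ} (ht : t ∈ Icc 0 tb) (hx : x₀ t < x) :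
    HasDerivAt (fun x => u x t) (uX u x t) x :=
  (((h.contDiffOn_slice ht).differentiableOn (by simp)).differentiableAt
    (Ioi_mem_nhds hx)).hasDerivAt

lemma hasDerivAt_uX (h : ProfileFlow n tb K x₀ u) {x t : ℝ} (ht : t ∈ Icc 0 tb) (hx : x₀ t < x) :
    HasDerivAt (fun x => uX u x t) (uXX u x t) x :=
  ((((h.contDiffOn_slice ht).deriv_of_isOpen (m := (⊤ : ℕ∞)) isOpen_Ioi
    (by simp)).differentiableOn (by simp)).differentiableAt (Ioi_mem_nhds hx)).hasDerivAt

lemma uT_neg (h : ProfileFlow n tb K x₀ u) {x t : ℝ} (ht : t ∈ Icc 0 tb) (hx : x₀ t < x) :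
    uT u x t < 0 := by
  have hu := h.pos x t ht hx
  have hn : (2 : ℝ) ≤ n := by exact_mod_cast h.two_le
  rw [h.pde x t ht hx]
  have h1 := div_neg_of_neg_of_pos (h.uxx_neg x t ht hx)
    (show (0 : ℝ) < 1 + (uX u x t) ^ 2 by positivity)
  have h2 : 0 < ((n : ℝ) - 1) / u x t := div_pos (by linarith) hu
  linarith

lemma hasDerivAt_time (h : ProfileFlow n tb K x₀ u) {x t : ℝ} (ht : t ∈ Icc 0 tb)
    (hx : x₀ t < x) : HasDerivAt (fun t => u x t) (uT u x t) t := by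
  by_cases hd : DifferentiableAt ℝ (fun t => u x t) t
  · exact hd.hasDerivAt
  · exact absurd (deriv_zero_of_not_differentiableAt hd) (h.uT_neg ht hx).ne

lemma tendsto_time (h : ProfileFlow n tb K x₀ u) {x t : ℝ} (ht : t ∈ Icc 0 tb)
    (hx : x₀ t < x) : Tendsto (fun t => u x t) (𝓝 t) (𝓝 (u x t)) :=
  (h.hasDerivAt_time ht hx).continuousAt

lemma strictMonoOn (h : ProfileFlow n tb K x₀ u) {t : ℝ} (ht : t ∈ Icc 0 tb) :
    StrictMonoOn (fun x => u x t) (Ioi (x₀ t)) := by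
  refine strictMonoOn_of_deriv_pos (convex_Ioi _) (h.contDiffOn_slice ht).continuousOn ?_
  intro x hx
  rw [interior_Ioi] at hx
  exact h.ux_pos x t ht hx

lemma antitoneOn_uX (h : ProfileFlow n tb K x₀ u) {t : ℝ} (ht : t ∈ Icc 0 tb) :
    AntitoneOn (fun x => uX u x t) (Ioi (x₀ t)) := by
  refine antitoneOn_of_deriv_nonpos (convex_Ioi _)
    (fun x hx => (h.hasDerivAt_uX ht hx).continuousAt.continuousWithinAt)
    (fun x hx => (h.hasDerivAt_uX ht (interior_subset hx)).differentiableAt.differentiableWithinAt)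
    fun x hx => ?_
  rw [interior_Ioi] at hx
  exact (h.uxx_neg x t ht hx).le

lemma kappa1_pos (h : ProfileFlow n tb K x₀ u) {x t : ℝ} (ht : t ∈ Icc 0 tb)
    (hx : x₀ t < x) : 0 < kappa1 u x t := by
  have := h.pos x t ht hx
  unfold kappa1; positivity

lemma kappaN_pos (h : ProfileFlow n tb K x₀ u) {x t : ℝ} (ht : t ∈ Icc 0 tb)
    (hx : x₀ t < x) : 0 < kappaN u x t := by
  rw [kappaN_eq]
  exact div_pos (neg_pos.2 (h.uxx_neg x t ht hx)) (by positivity)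

lemma one_le_mul (h : ProfileFlow n tb K x₀ u) {x t : ℝ} (ht : t ∈ Icc 0 tb)
    (hx : x₀ t < x) : 1 ≤ K * (u x t * √(1 + (uX u x t) ^ 2)) := by
  have hu := h.pos x t ht hx
  have := h.kappa1_le x t ht hx
  unfold kappa1 at this
  rwa [div_le_iff₀ (by positivity)] at this

lemma K_pos (h : ProfileFlow n tb K x₀ u) {t : ℝ} (ht : t ∈ Icc 0 tb) : 0 < K :=
  have hx : x₀ t < x₀ t + 1 := by linarith
  (h.kappa1_pos ht hx).trans_le (h.kappa1_le _ t ht hx)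

lemma one_le_uX (h : ProfileFlow n tb K x₀ u) {x t : ℝ} (ht : t ∈ Icc 0 tb)
    (hx : x₀ t < x) (hu : u x t ≤ 1 / (2 * K)) : 1 ≤ uX u x t := by
  have hK := h.K_pos ht
  have h1 := h.one_le_mul ht hx
  have hp := h.ux_pos x t ht hx
  have hu0 := h.pos x t ht hx
  have h2 : K * u x t ≤ 1 / 2 := by
    rw [le_div_iff₀ (by positivity)] at hu; linarith
  have hs : 0 ≤ √(1 + (uX u x t) ^ 2) := Real.sqrt_nonneg _
  have h3 : 2 ≤ √(1 + (uX u x t) ^ 2) := by nlinarith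
  have h4 := Real.sq_sqrt (show 0 ≤ 1 + (uX u x t) ^ 2 by positivity)
  nlinarith

lemma min_le_u (h : ProfileFlow n tb K x₀ u) {x t : ℝ} (ht : t ∈ Icc 0 tb)
    (hx : x₀ t < x) : min (1 / (2 * K)) (x - x₀ t) ≤ u x t := by
  by_contra! hlt
  obtain ⟨h1, h2⟩ := lt_min_iff.1 hlt
  have key : ∀ z ∈ Ioo (x₀ t) x, x - z ≤ u x t := by
    intro z hz
    obtain ⟨c, hc, he⟩ := exists_hasDerivAt_eq_slope (fun x => u x t) (fun x => uX u x t) hz.2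
      (fun y hy => (h.hasDerivAt_u ht (hz.1.trans_le hy.1)).continuousAt.continuousWithinAt)
      (fun y hy => h.hasDerivAt_u ht (hz.1.trans hy.1))
    have hcx : x₀ t < c := hz.1.trans hc.1
    have h3 := h.one_le_uX ht hcx ((h.strictMonoOn ht hcx hx hc.2).le.trans h1.le)
    have hzx := sub_pos.2 hz.2
    rw [he, le_div_iff₀ hzx] at h3
    have := h.pos z t ht hz.1
    linarith
  have := key ((x₀ t + (x - u x t)) / 2)
    ⟨by linarith, by linarith [h.pos x t ht hx]⟩
  linarith

lemma le_sin_angle (h : ProfileFlow n tb K x₀ u) {x t : ℝ} (ht : t ∈ Icc 0 tb)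
    (hx : x₀ t < x) :
    1 - K * (x - x₀ t) ≤ uX u x t / √(1 + (uX u x t) ^ 2) := by
  have hK := h.K_pos ht
  have hmono : MonotoneOn (fun x => uX u x t / √(1 + (uX u x t) ^ 2) + K * x) (Ioi (x₀ t)) := by
    have hd : ∀ y ∈ Ioi (x₀ t), HasDerivAt
        (fun x => uX u x t / √(1 + (uX u x t) ^ 2) + K * x) (-kappaN u y t + K) y := by
      intro y hy
      have h1 := (hasDerivAt_div_sqrt_one_add_sq (uX u y t)).comp y (h.hasDerivAt_uX ht hy)
      refine (h1.add ((hasDerivAt_id y).const_mul K)).congr_deriv ?_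
      rw [kappaN_eq]; ring
    refine monotoneOn_of_deriv_nonneg (convex_Ioi _)
      (fun y hy => (hd y hy).continuousAt.continuousWithinAt)
      (fun y hy => (hd y (interior_subset hy)).differentiableAt.differentiableWithinAt) ?_
    intro y hy
    rw [interior_Ioi] at hy
    rw [(hd y hy).deriv]
    linarith [h.kappaN_le y t ht hy]
  have hlim : Tendsto (fun z => 1 - K * u z t + K * (z - x)) (𝓝[>] (x₀ t))
      (𝓝 (1 - K * 0 + K * (x₀ t - x))) :=
    ((h.tip t ht).const_mul K).const_sub 1 |>.add
      (((continuous_id.tendsto (x₀ t)).mono_left nhdsWithin_le_nhds).sub_const x |>.const_mul K)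
  have hle : ∀ᶠ z in 𝓝[>] (x₀ t),
      1 - K * u z t + K * (z - x) ≤ uX u x t / √(1 + (uX u x t) ^ 2) := by
    filter_upwards [Ioo_mem_nhdsGT hx] with z hz
    have h1 := hmono hz.1 hx hz.2.le
    have h2 : 1 - K * u z t ≤ uX u z t / √(1 + (uX u z t) ^ 2) := by
      have h3 := h.one_le_mul ht hz.1
      have hp := h.ux_pos z t ht hz.1
      have hu := h.pos z t ht hz.1
      have hs : 0 < √(1 + (uX u z t) ^ 2) := by positivity
      have h4 := Real.sq_sqrt (show 0 ≤ 1 + (uX u z t) ^ 2 by positivity)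
      rw [le_div_iff₀ hs]
      nlinarith
    simp only at h1
    linarith
  have := le_of_tendsto hlim hle
  linarith

/-- Points where `u` is bounded below stay away from the tip, locally uniformly in time. -/
lemma exists_eventually_lt (h : ProfileFlow n tb K x₀ u) {t c : ℝ} (ht : t ∈ Icc 0 tb)
    (hc : 0 < c) :
    ∃ y, x₀ t < y ∧ ∀ᶠ t' in 𝓝[Icc 0 tb] t, ∀ x, x₀ t' < x → c ≤ u x t' → y < x := by
  obtain ⟨y, hyc, hy : x₀ t < y⟩ := (((h.tip t ht).eventually (gt_mem_nhds hc)).and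
    self_mem_nhdsWithin).exists
  refine ⟨y, hy, ?_⟩
  filter_upwards [nhdsWithin_le_nhds ((h.tendsto_time ht hy).eventually (gt_mem_nhds hyc)),
    self_mem_nhdsWithin] with t' h1 ht' x hx hcx
  by_contra! hle
  exact absurd ((h.strictMonoOn ht').monotoneOn hx (hx.trans_le hle) hle)
    (not_le.2 (h1.trans_le hcx))

lemma eventually_lt_tip (h : ProfileFlow n tb K x₀ u) {t m : ℝ} (ht : t ∈ Icc 0 tb)
    (hm : m < x₀ t) : ∀ᶠ t' in 𝓝[Icc 0 tb] t, m < x₀ t' := by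
  have hK := h.K_pos ht
  set x := (m + x₀ t) / 2 with hx
  obtain ⟨y, hy, hev⟩ := h.exists_eventually_lt ht
    (show 0 < min (1 / (2 * K)) (x - m) from lt_min (by positivity) (by linarith))
  filter_upwards [hev, self_mem_nhdsWithin] with t' h1 ht'
  by_contra! hle
  have hxt : x₀ t' < x := by linarith
  have := h1 x hxt ((min_le_min le_rfl (by linarith)).trans (h.min_le_u ht' hxt))
  linarith

/-- Where the tip stays bounded, it is upper semicontinuous in time. -/
lemma eventually_tip_lt (h : ProfileFlow n tb K x₀ u) {S : Set ℝ} (hS : S ⊆ Icc 0 tb)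
    {t M : ℝ} (ht : t ∈ Icc 0 tb) (hM : ∀ᶠ t' in 𝓝[S] t, x₀ t' ≤ M) {x : ℝ} (hx : x₀ t < x) :
    ∀ᶠ t' in 𝓝[S] t, x₀ t' < x := by
  by_contra hcon
  have hfr : ∃ᶠ t' in 𝓝[S] t, x₀ t' ∈ Icc x M := by
    refine ((not_eventually.1 hcon).and_eventually hM).mono fun t' h' => ?_
    exact ⟨not_lt.1 h'.1, h'.2⟩
  obtain ⟨ξ, hξ, hcl⟩ := isCompact_Icc.exists_mapClusterPt_of_frequently hfr
  have hK := h.K_pos ht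
  set p := uX u x t with hp
  set σ := (p + 1) / √(1 + (p + 1) ^ 2) with hσ
  have hσ1 : σ < 1 := div_sqrt_one_add_sq_lt_one _
  obtain ⟨d, hd, hKd⟩ : ∃ d, 0 < d ∧ 3 * K * d < 1 - σ :=
    ⟨(1 - σ) / (6 * K), div_pos (by linarith) (by positivity), by
      field_simp; linarith⟩
  have hy1 : x₀ t < ξ + d := by linarith [hξ.1]
  have hy2 : x₀ t < ξ + 2 * d := by linarith [hξ.1]
  have hslope : u (ξ + 2 * d) t - u (ξ + d) t ≤ p * d := by
    obtain ⟨c, hc, he⟩ := exists_hasDerivAt_eq_slope (fun x => u x t) (fun x => uX u x t)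
      (show ξ + d < ξ + 2 * d by linarith)
      (fun y hy => (h.hasDerivAt_u ht (hy1.trans_le hy.1)).continuousAt.continuousWithinAt)
      (fun y hy => h.hasDerivAt_u ht (hy1.trans hy.1))
    have h1 : uX u c t ≤ p :=
      h.antitoneOn_uX ht hx (hy1.trans hc.1) (by linarith [hξ.1, hc.1])
    rw [he, div_le_iff₀ (by linarith)] at h1
    linarith
  have hdiff := ((h.tendsto_time ht hy2).sub (h.tendsto_time ht hy1)).eventually
    (gt_mem_nhds (show u (ξ + 2 * d) t - u (ξ + d) t < (p + 1) * d by nlinarith))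
  have hnear : ∃ᶠ t' in 𝓝[S] t, x₀ t' ∈ Ioo (ξ - d) (ξ + d) :=
    hcl.frequently (Ioo_mem_nhds (by linarith) (by linarith))
  obtain ⟨t', ⟨hn, hdf⟩, htS⟩ :=
    ((hnear.and_eventually (nhdsWithin_le_nhds hdiff)).and_eventually self_mem_nhdsWithin).exists
  have ht' := hS htS
  obtain ⟨c, hc, he⟩ := exists_hasDerivAt_eq_slope (fun x => u x t') (fun x => uX u x t')
    (show ξ + d < ξ + 2 * d by linarith)
    (fun y hy => (h.hasDerivAt_u ht' (hn.2.trans_le hy.1)).continuousAt.continuousWithinAt)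
    (fun y hy => h.hasDerivAt_u ht' (hn.2.trans hy.1))
  have hux : uX u (ξ + 2 * d) t' ≤ p + 1 := by
    refine (h.antitoneOn_uX ht' (hn.2.trans hc.1) (show x₀ t' < ξ + 2 * d by linarith [hn.2])
      hc.2.le).trans ?_
    simp only
    rw [he, div_le_iff₀ (by linarith)]
    linarith
  have h1 := strictMono_div_sqrt_one_add_sq.monotone hux
  have h2 := h.le_sin_angle ht' (show x₀ t' < ξ + 2 * d by linarith [hn.2])
  nlinarith [hn.1]

lemma mem_nhdsWithin_strip (h : ProfileFlow n tb K x₀ u) {x t : ℝ} (ht : t ∈ Icc 0 tb)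
    (hB : IsBoundedUnder (· ≤ ·) (𝓝[Icc 0 tb] t) x₀) (hx : x₀ t < x) :
    profileDomain tb x₀ ∈ 𝓝[univ ×ˢ Icc 0 tb] (x, t) := by
  obtain ⟨M, hM⟩ := hB
  obtain ⟨y, hy, hyx⟩ := exists_between hx
  have h1 := h.eventually_tip_lt subset_rfl ht (eventually_map.1 hM) hy
  rw [nhdsWithin_prod_eq, nhdsWithin_univ]
  filter_upwards [prod_mem_prod (Ioi_mem_nhds hyx) (h1.and self_mem_nhdsWithin)] with p hp
  exact ⟨hp.2.2, hp.2.1.trans hp.1⟩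

lemma hasDerivWithinAt_path (h : ProfileFlow n tb K x₀ u) (htb : 0 < tb) {b L t : ℝ}
    (ht : t ∈ Icc 0 tb) (hB : IsBoundedUnder (· ≤ ·) (𝓝[Icc 0 tb] t) x₀)
    (hx : x₀ t < b + L * t) :
    HasDerivWithinAt (fun τ => u (b + L * τ) τ)
      (L * uX u (b + L * t) t + uT u (b + L * t) t) (Icc 0 tb) t := by
  set x := b + L * t with hxdef
  have hmem : ((x, t) : ℝ × ℝ) ∈ profileDomain tb x₀ := ⟨ht, hx⟩
  obtain ⟨A, hA⟩ := ((h.smooth.differentiableOn (by simp) _ hmem).mono_of_mem_nhdsWithin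
    (h.mem_nhdsWithin_strip ht hB hx))
  have hA10 : A (1, 0) = uX u x t := by
    have h1 := hA.comp_hasDerivWithinAt (s := univ) (f := fun y : ℝ => (y, t)) x
      (((hasDerivAt_id x).prodMk (hasDerivAt_const x t)).hasDerivWithinAt)
      (fun _ _ => ⟨trivial, ht⟩)
    exact (h1.hasDerivAt univ_mem).unique (h.hasDerivAt_u ht hx)
  have hA01 : A (0, 1) = uT u x t := by
    have h1 := hA.comp_hasDerivWithinAt (s := Icc 0 tb) (f := fun τ : ℝ => (x, τ)) t
      (((hasDerivAt_const t x).prodMk (hasDerivAt_id t)).hasDerivWithinAt)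
      (fun _ hτ => ⟨trivial, hτ⟩)
    exact (uniqueDiffOn_Icc htb t ht).eq_deriv _ h1 (h.hasDerivAt_time ht hx).hasDerivWithinAt
  have hpath : HasDerivAt (fun τ : ℝ => (b + L * τ, τ)) (L, 1) t := by
    have := (((hasDerivAt_id t).const_mul L).const_add b).prodMk (hasDerivAt_id t)
    simpa using this
  have h2 := hA.comp_hasDerivWithinAt (s := Icc 0 tb) (f := fun τ => (b + L * τ, τ)) t
    hpath.hasDerivWithinAt
    (fun _ hτ => ⟨trivial, hτ⟩)
  refine h2.congr_deriv ?_
  rw [← hA10, ← hA01, show ((L, 1) : ℝ × ℝ) = L • (1, 0) + (0, 1) by simp, map_add, map_smul,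
    smul_eq_mul]

lemma isClosed_path (h : ProfileFlow n tb K x₀ u) {b L c s r : ℝ} (hc : 0 < c)
    (hs : s ∈ Icc 0 tb) (hr : r ∈ Icc 0 tb) :
    IsClosed ({τ | x₀ τ < b + L * τ ∧ c ≤ u (b + L * τ) τ} ∩ Icc s r) := by
  set A := {τ | x₀ τ < b + L * τ ∧ c ≤ u (b + L * τ) τ} ∩ Icc s r with hA
  have hsub : A ⊆ Icc 0 tb := fun τ hτ => ⟨hs.1.trans hτ.2.1, hτ.2.2.trans hr.2⟩
  have hcont : Continuous fun τ : ℝ => b + L * τ := by fun_prop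
  refine isClosed_of_closure_subset fun t ht => ?_
  have htsr : t ∈ Icc s r := isClosed_Icc.closure_subset_iff.2 inter_subset_right ht
  have ht0 : t ∈ Icc 0 tb := ⟨hs.1.trans htsr.1, htsr.2.trans hr.2⟩
  have : (𝓝[A] t).NeBot := mem_closure_iff_nhdsWithin_neBot.1 ht
  obtain ⟨y, hy, hev⟩ := h.exists_eventually_lt ht0 hc
  have hle : y ≤ b + L * t := by
    refine ge_of_tendsto ((hcont.tendsto t).mono_left (nhdsWithin_le_nhds (s := A))) ?_
    filter_upwards [nhdsWithin_mono t hsub hev, self_mem_nhdsWithin] with τ h1 h2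
    exact (h1 _ h2.1.1 h2.1.2).le
  have hx := hy.trans_le hle
  refine ⟨⟨hx, ?_⟩, htsr⟩
  have hu : Tendsto (Function.uncurry u) (𝓝[profileDomain tb x₀] (b + L * t, t))
      (𝓝 (u (b + L * t) t)) := h.smooth.continuousOn _ ⟨ht0, hx⟩
  have hpath : Tendsto (fun τ : ℝ => (b + L * τ, τ)) (𝓝[A] t)
      (𝓝[profileDomain tb x₀] (b + L * t, t)) := by
    refine tendsto_nhdsWithin_iff.2 ⟨?_, ?_⟩
    · exact ((hcont.prodMk continuous_id).tendsto t).mono_left nhdsWithin_le_nhds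
    · filter_upwards [self_mem_nhdsWithin] with τ hτ using ⟨hsub hτ, hτ.1.1⟩
  refine ge_of_tendsto (hu.comp hpath) ?_
  filter_upwards [self_mem_nhdsWithin] with τ hτ using hτ.1.2

lemma neg_le_uT (h : ProfileFlow n tb K x₀ u) {x t : ℝ} (ht : t ∈ Icc 0 tb) (hx : x₀ t < x) :
    -(n * K * √(1 + (uX u x t) ^ 2)) ≤ uT u x t := by
  have hn : (2 : ℝ) ≤ n := by exact_mod_cast h.two_le
  have hu := h.pos x t ht hx
  have h1 := h.kappaN_le x t ht hx
  have h2 := h.kappa1_le x t ht hx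
  have hV : 0 < √(1 + (uX u x t) ^ 2) := by positivity
  have hsq := Real.sq_sqrt (show 0 ≤ 1 + (uX u x t) ^ 2 by positivity)
  rw [kappaN_eq] at h1
  unfold kappa1 at h2
  set V := √(1 + (uX u x t) ^ 2)
  rw [h.pde x t ht hx, ← hsq]
  have h3 : -uXX u x t / V ^ 3 * V = -(uXX u x t / V ^ 2) := by field_simp
  have h4 : 1 / (u x t * V) * V = 1 / u x t := by field_simp
  have h5 := mul_le_mul_of_nonneg_right h1 hV.le
  have h6 := mul_le_mul_of_nonneg_right h2 hV.le
  rw [h3] at h5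
  rw [h4] at h6
  have h7 := mul_le_mul_of_nonneg_left h6 (show (0 : ℝ) ≤ n - 1 by linarith)
  rw [mul_one_div] at h7
  linarith

/-- The tip advances with speed at most `2 n K`. -/
lemma tip_le_add (h : ProfileFlow n tb K x₀ u) (htb : 0 < tb) {s r : ℝ} (hs : s ∈ Icc 0 tb)
    (hr : r ∈ Icc 0 tb) (hsr : s ≤ r)
    (hB : ∀ τ ∈ Ico s r, IsBoundedUnder (· ≤ ·) (𝓝[Icc 0 tb] τ) x₀) :
    x₀ r ≤ x₀ s + 2 * n * K * (r - s) := by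
  have hK := h.K_pos hs
  have hn : (2 : ℝ) ≤ n := by exact_mod_cast h.two_le
  set L : ℝ := 2 * n * K with hL
  have hLpos : 0 < L := by positivity
  refine le_of_forall_gt_imp_ge_of_dense fun w hw => ?_
  set b := w - L * r with hb
  have hys : x₀ s < b + L * s := by simp only [hb]; linarith
  set c := min (u (b + L * s) s) (1 / (2 * K)) with hc
  have hcpos : 0 < c := lt_min (h.pos _ _ hs hys) (by positivity)
  have key := (h.isClosed_path (b := b) (L := L) hcpos hs hr).Icc_subset_of_forall_exists_gt
    ⟨hys, min_le_left _ _⟩ ?_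
  · have := (key (right_mem_Icc.2 hsr)).1
    simp only [hb] at this
    linarith
  rintro τ ⟨⟨hτ, hcτ⟩, hτsr⟩ z hz
  have hτ0 : τ ∈ Icc 0 tb := ⟨hs.1.trans hτsr.1, hτsr.2.le.trans hr.2⟩
  have hBτ := hB τ hτsr
  have hIcc : Icc 0 tb ∈ 𝓝[>] τ :=
    mem_of_superset (Ioo_mem_nhdsGT (hτsr.2.trans_le hr.2))
      fun y hy => ⟨hτ0.1.trans hy.1.le, hy.2.le⟩
  have hdom : ∀ᶠ τ' in 𝓝[>] τ, x₀ τ' < b + L * τ' := by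
    obtain ⟨M, hM⟩ := hBτ
    have h1 := nhdsWithin_le_of_mem hIcc
      (h.eventually_tip_lt subset_rfl hτ0 (eventually_map.1 hM) hτ)
    filter_upwards [h1, self_mem_nhdsWithin] with τ' h2 h3
    have : L * τ < L * τ' := mul_lt_mul_of_pos_left h3 hLpos
    linarith
  have hder : HasDerivWithinAt (fun τ => u (b + L * τ) τ) _ (Ioi τ) τ :=
    (h.hasDerivWithinAt_path htb hτ0 hBτ hτ).mono_of_mem_nhdsWithin hIcc
  have hval : ∀ᶠ τ' in 𝓝[>] τ, c ≤ u (b + L * τ') τ' := by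
    rcases hcτ.lt_or_eq with hlt | heq
    · exact (hder.continuousWithinAt.eventually (lt_mem_nhds hlt)).mono fun _ h => h.le
    · have h1 := h.one_le_uX hτ0 hτ (heq ▸ min_le_right _ _)
      have h2 := h.neg_le_uT hτ0 hτ
      have h3 : √(1 + (uX u (b + L * τ) τ) ^ 2) < 2 * uX u (b + L * τ) τ := by
        rw [Real.sqrt_lt' (by linarith)]; nlinarith
      have hpos : 0 < L * uX u (b + L * τ) τ + uT u (b + L * τ) τ := by
        have : n * K * √(1 + (uX u (b + L * τ) τ) ^ 2) < n * K * (2 * uX u (b + L * τ) τ) :=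
          mul_lt_mul_of_pos_left h3 (by positivity)
        simp only [hL]; linarith
      have hsl := (hasDerivWithinAt_iff_tendsto_slope' self_notMem_Ioi).1 hder
      filter_upwards [hsl.eventually (lt_mem_nhds hpos), self_mem_nhdsWithin] with τ' h4 h5
      have h6 := sub_pos.2 (show τ < τ' from h5)
      rw [slope_def_field, lt_div_iff₀ h6] at h4
      linarith
  obtain ⟨τ', ⟨h1, h2⟩, h3⟩ := ((hdom.and hval).and (Ioc_mem_nhdsGT hz)).exists
  exact ⟨τ', ⟨h1, h2⟩, h3⟩

lemma tip_le_tip (h : ProfileFlow n tb K x₀ u) {s r : ℝ} (hs : s ∈ Icc 0 tb)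
    (hr : r ∈ Icc 0 tb) (hsr : s ≤ r)
    (hB : ∀ τ ∈ Ioc s r, IsBoundedUnder (· ≤ ·) (𝓝[Icc 0 tb] τ) x₀) : x₀ s ≤ x₀ r := by
  refine le_of_forall_gt_imp_ge_of_dense fun x hx => ?_
  have hxr : x₀ r < x + 0 * r := by simpa using hx
  have hcl := h.isClosed_path (b := x) (L := 0) (h.pos _ _ hr hxr) hs hr
  have key := hcl.Icc_subset_of_forall_exists_lt ⟨hxr, le_rfl⟩ ?_
  · simpa using (key (left_mem_Icc.2 hsr)).1.le
  rintro τ ⟨⟨hτ, hcτ⟩, hτsr⟩ z hz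
  simp only [zero_mul, add_zero] at *
  have hτ0 : τ ∈ Icc 0 tb := ⟨hs.1.trans hτsr.1.le, hτsr.2.trans hr.2⟩
  have hIcc : Icc 0 tb ∈ 𝓝[<] τ :=
    mem_of_superset (Ioo_mem_nhdsLT hτsr.1)
      fun y hy => ⟨hs.1.trans hy.1.le, hy.2.le.trans hτ0.2⟩
  obtain ⟨M, hM⟩ := hB τ hτsr
  have hdom : ∀ᶠ τ' in 𝓝[<] τ, x₀ τ' < x := nhdsWithin_le_of_mem hIcc
      (h.eventually_tip_lt subset_rfl hτ0 (eventually_map.1 hM) hτ)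
  have hsl := (hasDerivWithinAt_iff_tendsto_slope' self_notMem_Iio).1
    (h.hasDerivAt_time hτ0 hτ).hasDerivWithinAt
  have hval : ∀ᶠ τ' in 𝓝[<] τ, u x r ≤ u x τ' := by
    filter_upwards [hsl.eventually (gt_mem_nhds (h.uT_neg hτ0 hτ)), self_mem_nhdsWithin]
      with τ' h4 h5
    have h6 := sub_neg.2 (show τ' < τ from h5)
    rw [slope_def_field, div_lt_iff_of_neg h6] at h4
    linarith
  obtain ⟨τ', ⟨h1, h2⟩, h3⟩ := ((hdom.and hval).and (Ico_mem_nhdsLT hz)).exists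
  exact ⟨τ', ⟨h1, h2⟩, h3⟩

/-- The tip position is locally bounded in time; the exceptional times form a closed set without
points at which they are locally bounded, which Baire's theorem excludes. -/
lemma isBoundedUnder_tip (h : ProfileFlow n tb K x₀ u) (htb : 0 < tb) {t : ℝ}
    (ht : t ∈ Icc 0 tb) : IsBoundedUnder (· ≤ ·) (𝓝[Icc 0 tb] t) x₀ := by
  have hK := h.K_pos ht
  have hn : (2 : ℝ) ≤ n := by exact_mod_cast h.two_le
  set N := {t | t ∈ Icc 0 tb ∧ ¬ IsBoundedUnder (· ≤ ·) (𝓝[Icc 0 tb] t) x₀} with hN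
  have hgood : ∀ τ ∈ Icc 0 tb, τ ∉ N → IsBoundedUnder (· ≤ ·) (𝓝[Icc 0 tb] τ) x₀ :=
    fun τ h1 h2 => by_contra fun h3 => h2 ⟨h1, h3⟩
  have hNcl : IsClosed N := by
    refine isClosed_of_closure_subset fun τ hτ => ?_
    have hτ0 : τ ∈ Icc 0 tb := isClosed_Icc.closure_subset_iff.2 (fun _ h => h.1) hτ
    refine ⟨hτ0, fun ⟨M, hM⟩ => ?_⟩
    have := mem_closure_iff_nhdsWithin_neBot.1 hτ
    have h1 := nhdsWithin_mono τ (fun _ h => h.1 : N ⊆ Icc 0 tb)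
      (eventually_eventually_nhdsWithin.2 (eventually_map.1 hM))
    obtain ⟨τ', h2, h3⟩ := ((show ∀ᶠ _ in 𝓝[N] τ, _ from h1).and self_mem_nhdsWithin).exists
    exact h3.2 ⟨M, eventually_map.2 h2⟩
  by_contra hcon
  have : Nonempty N := ⟨⟨t, ht, hcon⟩⟩
  have : CompleteSpace N := hNcl.isComplete.completeSpace_coe
  obtain ⟨k, t₁, ht₁⟩ := nonempty_interior_of_iUnion_of_closed
    (f := fun k : ℕ => {t : N | x₀ t ≤ k}) (fun k => by
      refine isOpen_compl_iff.1 (isOpen_iff_mem_nhds.2 fun τ hτ => ?_)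
      have h1 := h.eventually_lt_tip τ.2.1 (not_le.1 hτ)
      have h2 : Tendsto ((↑) : N → ℝ) (𝓝 τ) (𝓝[Icc 0 tb] (τ : ℝ)) :=
        tendsto_nhdsWithin_iff.2 ⟨continuous_subtype_val.tendsto τ,
          Eventually.of_forall fun τ' => τ'.2.1⟩
      filter_upwards [h2.eventually h1] with τ' h3 using not_le.2 h3)
    (eq_univ_of_forall fun τ => mem_iUnion.2 (exists_nat_ge (x₀ τ)))
  obtain ⟨δ, hδ, hball⟩ := Metric.mem_nhds_iff.1 (mem_interior_iff_mem_nhds.1 ht₁)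
  have hNk : ∀ τ ∈ N, |τ - t₁| < δ → x₀ τ < k + 1 := fun τ hτ hd => by
    have : x₀ τ ≤ k := hball (show (⟨τ, hτ⟩ : N) ∈ Metric.ball t₁ δ from hd)
    linarith
  have hcomp : ∀ a b : ℝ, IsCompact (N ∩ Icc a b) := fun a b => isCompact_Icc.inter_left hNcl
  refine t₁.2.2 ⟨k + 1 + 2 * n * K * tb, eventually_map.2 ?_⟩
  filter_upwards [self_mem_nhdsWithin, nhdsWithin_le_nhds (Metric.ball_mem_nhds (t₁ : ℝ) hδ)]
    with s hs hsd
  have hLtb : 0 ≤ 2 * n * K * tb := by positivity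
  rw [Metric.mem_ball, Real.dist_eq, abs_lt] at hsd
  by_cases hsN : s ∈ N
  · linarith [hNk s hsN (abs_lt.2 hsd)]
  rcases le_total (t₁ : ℝ) s with hts | hts
  · obtain ⟨haN, ha⟩ := (hcomp t₁ s).sSup_mem ⟨t₁, t₁.2, le_rfl, hts⟩
    set a := sSup (N ∩ Icc t₁ s) with hadef
    have has : a < s := lt_of_le_of_ne ha.2 fun he => hsN (he ▸ haN)
    have hBa : ∀ τ ∈ Ioc a s, IsBoundedUnder (· ≤ ·) (𝓝[Icc 0 tb] τ) x₀ := fun τ hτ =>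
      hgood τ ⟨haN.1.1.trans hτ.1.le, hτ.2.trans hs.2⟩ fun hτN => hτ.1.not_ge
        (le_csSup (hcomp t₁ s).bddAbove ⟨hτN, ha.1.trans hτ.1.le, hτ.2⟩)
    have hsub : Ioc a s ⊆ Icc 0 tb := fun τ hτ => ⟨haN.1.1.trans hτ.1.le, hτ.2.trans hs.2⟩
    have hbd : ∀ᶠ τ in 𝓝[Ioc a s] a, x₀ τ ≤ x₀ s := by
      filter_upwards [self_mem_nhdsWithin] with τ hτ
      exact h.tip_le_tip (hsub hτ) hs hτ.2 fun σ hσ => hBa σ ⟨hτ.1.trans hσ.1, hσ.2⟩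
    have hak := hNk a haN (abs_lt.2 ⟨by linarith [ha.1], by linarith [ha.2]⟩)
    have hlt := h.eventually_tip_lt hsub haN.1 hbd hak
    rw [nhdsWithin_Ioc_eq_nhdsGT has] at hlt
    obtain ⟨a', ha1, ha2⟩ := (hlt.and (Ioc_mem_nhdsGT has)).exists
    have h1 := h.tip_le_add htb (hsub ha2) hs ha2.2
      fun σ hσ => hBa σ ⟨ha2.1.trans_le hσ.1, hσ.2.le⟩
    have h2 : 2 * n * K * (s - a') ≤ 2 * n * K * tb :=
      mul_le_mul_of_nonneg_left (by linarith [hs.2, (hsub ha2).1]) (by positivity)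
    linarith
  · obtain ⟨hbN, hb⟩ := (hcomp s t₁).sInf_mem ⟨t₁, t₁.2, hts, le_rfl⟩
    set b := sInf (N ∩ Icc s t₁) with hbdef
    have hsb : s < b := lt_of_le_of_ne hb.1 fun he => hsN (he ▸ hbN)
    have hBb : ∀ τ ∈ Ico s b, IsBoundedUnder (· ≤ ·) (𝓝[Icc 0 tb] τ) x₀ := fun τ hτ =>
      hgood τ ⟨hs.1.trans hτ.1, hτ.2.le.trans hbN.1.2⟩ fun hτN => hτ.2.not_ge
        (csInf_le (hcomp s t₁).bddBelow ⟨hτN, hτ.1, hτ.2.le.trans hb.2⟩)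
    have hsub : Ico s b ⊆ Icc 0 tb := fun τ hτ => ⟨hs.1.trans hτ.1, hτ.2.le.trans hbN.1.2⟩
    have hbd : ∀ᶠ τ in 𝓝[Ico s b] b, x₀ τ ≤ x₀ s + 2 * n * K * tb := by
      filter_upwards [self_mem_nhdsWithin] with τ hτ
      have h1 := h.tip_le_add htb hs (hsub hτ) hτ.1
        fun σ hσ => hBb σ ⟨hσ.1, hσ.2.trans hτ.2⟩
      have h2 : 2 * n * K * (τ - s) ≤ 2 * n * K * tb :=
        mul_le_mul_of_nonneg_left (by linarith [hs.1, (hsub hτ).2]) (by positivity)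
      linarith
    have hbk := hNk b hbN (abs_lt.2 ⟨by linarith [hb.1], by linarith [hb.2]⟩)
    have hlt := h.eventually_tip_lt hsub hbN.1 hbd hbk
    rw [nhdsWithin_Ico_eq_nhdsLT hsb] at hlt
    obtain ⟨r, hr1, hr2⟩ := (hlt.and (Ico_mem_nhdsLT hsb)).exists
    have h1 := h.tip_le_tip hs (hsub hr2) hr2.1
      fun σ hσ => hBb σ ⟨hσ.1.le, hσ.2.trans_lt hr2.2⟩
    linarith

lemma nhdsWithin_profileDomain (h : ProfileFlow n tb K x₀ u) (htb : 0 < tb) {p : ℝ × ℝ}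
    (hp : p ∈ profileDomain tb x₀) :
    𝓝[profileDomain tb x₀] p = 𝓝[univ ×ˢ Icc 0 tb] p :=
  le_antisymm (nhdsWithin_mono p fun _ hq => ⟨trivial, hq.1⟩) (nhdsWithin_le_of_mem
    (h.mem_nhdsWithin_strip hp.1 (h.isBoundedUnder_tip htb hp.1) hp.2))

lemma uniqueDiffOn_profileDomain (h : ProfileFlow n tb K x₀ u) (htb : 0 < tb) :
    UniqueDiffOn ℝ (profileDomain tb x₀) := fun p hp =>
  ((uniqueDiffOn_univ.prod (uniqueDiffOn_Icc htb)) p ⟨trivial, hp.1⟩).mono_nhds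
    (h.nhdsWithin_profileDomain htb hp).ge

lemma subset_closure_interior (h : ProfileFlow n tb K x₀ u) (htb : 0 < tb) :
    profileDomain tb x₀ ⊆ closure (interior (profileDomain tb x₀)) := by
  intro p hp
  have hcl : p ∈ closure ((univ : Set ℝ) ×ˢ Ioo 0 tb) := by
    rw [closure_prod_eq, closure_Ioo htb.ne, closure_univ]
    exact ⟨trivial, hp.1⟩
  refine mem_closure_iff_frequently.2 ?_
  have := mem_closure_iff_nhdsWithin_neBot.1 hcl
  have hev : ∀ᶠ q in 𝓝[(univ : Set ℝ) ×ˢ Ioo 0 tb] p,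
      q ∈ interior (profileDomain tb x₀) := by
    have h1 : profileDomain tb x₀ ∈ 𝓝[(univ : Set ℝ) ×ˢ Ioo 0 tb] p :=
      nhdsWithin_mono p (prod_mono_right Ioo_subset_Icc_self)
        (h.nhdsWithin_profileDomain htb hp ▸ self_mem_nhdsWithin)
    filter_upwards [h1, self_mem_nhdsWithin] with q hq hq'
    rw [mem_interior_iff_mem_nhds,
      ← nhdsWithin_eq_nhds.2 (prod_mem_nhds univ_mem (Icc_mem_nhds hq'.2.1 hq'.2.2)),
      ← h.nhdsWithin_profileDomain htb hq]
    exact self_mem_nhdsWithin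
  exact hev.frequently.filter_mono nhdsWithin_le_nhds

lemma eventually_slice {x t : ℝ} (hp : (x, t) ∈ profileDomain tb x₀) :
    ∀ᶠ y in 𝓝 x, (y, t) ∈ profileDomain tb x₀ := by
  filter_upwards [Ioi_mem_nhds hp.2] with y hy using ⟨hp.1, hy⟩

lemma eventually_time (h : ProfileFlow n tb K x₀ u) (htb : 0 < tb) {x t : ℝ}
    (hp : (x, t) ∈ profileDomain tb x₀) :
    ∀ᶠ τ in 𝓝[Icc 0 tb] t, (x, τ) ∈ profileDomain tb x₀ := by
  obtain ⟨M, hM⟩ := h.isBoundedUnder_tip htb hp.1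
  filter_upwards [h.eventually_tip_lt subset_rfl hp.1 (eventually_map.1 hM) hp.2,
    self_mem_nhdsWithin] with τ h1 h2 using ⟨h2, h1⟩

section slices

variable {E : Type*} [NormedAddCommGroup E] [NormedSpace ℝ E] {Φ : ℝ × ℝ → E}
  {A : ℝ × ℝ →L[ℝ] E} {x t : ℝ}

lemma hasDerivAt_slice (h : ProfileFlow n tb K x₀ u) (htb : 0 < tb)
    (hp : (x, t) ∈ profileDomain tb x₀)
    (hA : HasFDerivWithinAt Φ A (profileDomain tb x₀) (x, t)) :
    HasDerivAt (fun y => Φ (y, t)) (A (1, 0)) x :=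
  ((hA.mono_of_mem_nhdsWithin (h.nhdsWithin_profileDomain htb hp ▸ self_mem_nhdsWithin :
      profileDomain tb x₀ ∈ 𝓝[univ ×ˢ Icc 0 tb] (x, t))).comp_hasDerivWithinAt (s := univ)
    (f := fun y : ℝ => (y, t)) x
    (((hasDerivAt_id x).prodMk (hasDerivAt_const x t)).hasDerivWithinAt)
    (fun _ _ => ⟨trivial, hp.1⟩)).hasDerivAt univ_mem

lemma hasDerivWithinAt_slice (h : ProfileFlow n tb K x₀ u) (htb : 0 < tb)
    (hp : (x, t) ∈ profileDomain tb x₀)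
    (hA : HasFDerivWithinAt Φ A (profileDomain tb x₀) (x, t)) :
    HasDerivWithinAt (fun τ => Φ (x, τ)) (A (0, 1)) (Icc 0 tb) t :=
  (hA.mono_of_mem_nhdsWithin (h.nhdsWithin_profileDomain htb hp ▸ self_mem_nhdsWithin :
      profileDomain tb x₀ ∈ 𝓝[univ ×ˢ Icc 0 tb] (x, t))).comp_hasDerivWithinAt (s := Icc 0 tb)
    (f := fun τ : ℝ => (x, τ)) t
    (((hasDerivAt_const t x).prodMk (hasDerivAt_id t)).hasDerivWithinAt)
    (fun _ hτ => ⟨trivial, hτ⟩)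

end slices

section mixed

variable {f G : ℝ → ℝ → ℝ} {x t : ℝ}

lemma uX_eq_fderivWithin (h : ProfileFlow n tb K x₀ u) (htb : 0 < tb)
    (hf : ContDiffOn ℝ (⊤ : ℕ∞) (Function.uncurry f) (profileDomain tb x₀))
    (hp : (x, t) ∈ profileDomain tb x₀) :
    uX f x t = fderivWithin ℝ (Function.uncurry f) (profileDomain tb x₀) (x, t) (1, 0) :=
  (h.hasDerivAt_slice htb hp
    (hf.differentiableOn (by simp) _ hp).hasFDerivWithinAt).deriv

lemma hasDerivAt_uX_of_smooth (h : ProfileFlow n tb K x₀ u) (htb : 0 < tb)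
    (hf : ContDiffOn ℝ (⊤ : ℕ∞) (Function.uncurry f) (profileDomain tb x₀))
    (hp : (x, t) ∈ profileDomain tb x₀) : HasDerivAt (fun y => f y t) (uX f x t) x := by
  rw [h.uX_eq_fderivWithin htb hf hp]
  exact h.hasDerivAt_slice htb hp (hf.differentiableOn (by simp) _ hp).hasFDerivWithinAt

lemma contDiffOn_uX (h : ProfileFlow n tb K x₀ u) (htb : 0 < tb)
    (hf : ContDiffOn ℝ (⊤ : ℕ∞) (Function.uncurry f) (profileDomain tb x₀)) :
    ContDiffOn ℝ (⊤ : ℕ∞) (Function.uncurry (uX f)) (profileDomain tb x₀) :=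
  ((hf.fderivWithin (m := (⊤ : ℕ∞)) (h.uniqueDiffOn_profileDomain htb) (by simp)).clm_apply
    contDiffOn_const).congr fun _ hp => h.uX_eq_fderivWithin htb hf hp

/-- Interchange of the space and time derivatives. -/
lemma hasDerivWithinAt_uX (h : ProfileFlow n tb K x₀ u) (htb : 0 < tb)
    (hf : ContDiffOn ℝ (⊤ : ℕ∞) (Function.uncurry f) (profileDomain tb x₀))
    (hG : ∀ x t, (x, t) ∈ profileDomain tb x₀ →
      HasDerivWithinAt (fun τ => f x τ) (G x t) (Icc 0 tb) t)
    (hp : (x, t) ∈ profileDomain tb x₀) {G' : ℝ} (hG' : HasDerivAt (fun y => G y t) G' x) :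
    HasDerivWithinAt (fun τ => uX f x τ) G' (Icc 0 tb) t := by
  set D := profileDomain tb x₀
  have hU := h.uniqueDiffOn_profileDomain htb
  have h2 := ((hf.fderivWithin (m := (⊤ : ℕ∞)) hU (by simp)).differentiableOn
    (by simp) _ hp).hasFDerivWithinAt
  set B := fderivWithin ℝ (fderivWithin ℝ (Function.uncurry f) D) D (x, t)
  have hx := (h.hasDerivAt_slice htb hp h2).clm_apply (hasDerivAt_const x ((0, 1) : ℝ × ℝ))
  have ht := (h.hasDerivWithinAt_slice htb hp h2).clm_apply
    (hasDerivWithinAt_const t (Icc 0 tb) ((1, 0) : ℝ × ℝ))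
  simp only [map_zero, add_zero] at hx ht
  have hsymm : B (1, 0) (0, 1) = B (0, 1) (1, 0) :=
    (hf _ hp).isSymmSndFDerivWithinAt (by
      simpa using WithTop.coe_le_coe.2 (le_top : (2 : ℕ∞) ≤ ⊤)) hU
      (h.subset_closure_interior htb hp) hp _ _
  have hxG : (fun y => fderivWithin ℝ (Function.uncurry f) D (y, t) (0, 1)) =ᶠ[𝓝 x]
      fun y => G y t := by
    filter_upwards [eventually_slice hp] with y hy
    exact (uniqueDiffOn_Icc htb t hp.1).eq_deriv _ (h.hasDerivWithinAt_slice htb hy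
      (hf.differentiableOn (by simp) _ hy).hasFDerivWithinAt) (hG y t hy)
  rw [← hG'.unique (hx.congr_of_eventuallyEq hxG.symm)] at hsymm
  rw [hsymm]
  refine ht.congr_of_eventuallyEq ?_ (h.uX_eq_fderivWithin htb hf hp)
  filter_upwards [h.eventually_time htb hp] with τ hτ using h.uX_eq_fderivWithin htb hf hτ

end mixed

section evolution

variable {x t : ℝ}

lemma hasDerivWithinAt_u_time (h : ProfileFlow n tb K x₀ u) (hp : (x, t) ∈ profileDomain tb x₀) :
    HasDerivWithinAt (fun τ => u x τ)
      (uXX u x t / (1 + uX u x t ^ 2) - (n - 1) / u x t) (Icc 0 tb) t := by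
  rw [← h.pde x t hp.1 hp.2]
  exact (h.hasDerivAt_time hp.1 hp.2).hasDerivWithinAt

lemma contDiffOn_uXX (h : ProfileFlow n tb K x₀ u) (htb : 0 < tb) :
    ContDiffOn ℝ (⊤ : ℕ∞) (Function.uncurry (uXX u)) (profileDomain tb x₀) :=
  h.contDiffOn_uX htb (h.contDiffOn_uX htb h.smooth)

lemma hasDerivWithinAt_uX_time (h : ProfileFlow n tb K x₀ u) (htb : 0 < tb)
    (hp : (x, t) ∈ profileDomain tb x₀) :
    HasDerivWithinAt (fun τ => uX u x τ)
      (uX (uXX u) x t / (1 + uX u x t ^ 2)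
        - 2 * uX u x t * uXX u x t ^ 2 / (1 + uX u x t ^ 2) ^ 2
        + (n - 1) * uX u x t / u x t ^ 2) (Icc 0 tb) t := by
  refine h.hasDerivWithinAt_uX htb h.smooth (fun _ _ hq => h.hasDerivWithinAt_u_time hq) hp ?_
  have hu := h.pos x t hp.1 hp.2
  have hV : 1 + uX u x t ^ 2 ≠ 0 := by positivity
  refine (((h.hasDerivAt_uX_of_smooth htb (h.contDiffOn_uXX htb) hp).div
    (((h.hasDerivAt_uX hp.1 hp.2).pow 2).const_add 1) hV).sub
    ((hasDerivAt_const x ((n : ℝ) - 1)).div (h.hasDerivAt_u hp.1 hp.2) hu.ne')).congr_deriv ?_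
  simp only [Pi.pow_apply]
  field_simp
  ring

lemma hasDerivWithinAt_uXX_time (h : ProfileFlow n tb K x₀ u) (htb : 0 < tb)
    (hp : (x, t) ∈ profileDomain tb x₀) :
    HasDerivWithinAt (fun τ => uXX u x τ)
      (uX (uX (uXX u)) x t / (1 + uX u x t ^ 2)
        - 2 * uX u x t * uXX u x t * uX (uXX u) x t / (1 + uX u x t ^ 2) ^ 2
        - 2 * (uXX u x t ^ 3 + 2 * uX u x t * uXX u x t * uX (uXX u) x t)
          / (1 + uX u x t ^ 2) ^ 2
        + 8 * uX u x t ^ 2 * uXX u x t ^ 3 / (1 + uX u x t ^ 2) ^ 3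
        + (n - 1) * uXX u x t / u x t ^ 2 - 2 * (n - 1) * uX u x t ^ 2 / u x t ^ 3)
      (Icc 0 tb) t := by
  refine h.hasDerivWithinAt_uX htb (f := uX u) (h.contDiffOn_uX htb h.smooth)
    (fun _ _ hq => h.hasDerivWithinAt_uX_time htb hq) hp ?_
  have hu := h.pos x t hp.1 hp.2
  have hV : 1 + uX u x t ^ 2 ≠ 0 := by positivity
  have d0 := h.hasDerivAt_u hp.1 hp.2
  have d1 := h.hasDerivAt_uX hp.1 hp.2
  have d2 := h.hasDerivAt_uX_of_smooth htb (h.contDiffOn_uXX htb) hp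
  have d3 := h.hasDerivAt_uX_of_smooth htb (h.contDiffOn_uX htb (h.contDiffOn_uXX htb)) hp
  have dV := (d1.pow 2).const_add 1
  refine (((d3.div dV hV).sub (((d1.const_mul 2).mul (d2.pow 2)).div (dV.pow 2)
    (pow_ne_zero 2 hV))).add ((d1.const_mul ((n : ℝ) - 1)).div (d0.pow 2)
    (pow_ne_zero 2 hu.ne'))).congr_deriv ?_
  simp only [Pi.pow_apply, Pi.mul_apply]
  field_simp
  ring

/-- The curvature gap solves a linear parabolic equation whose reaction coefficient is at most
`|h|² - 2 n u_x² / (u² (1 + u_x²))`. -/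
lemma exists_gap_derivs (h : ProfileFlow n tb K x₀ u) (htb : 0 < tb)
    (ht : t ∈ Icc 0 tb) : ∃ Zx : ℝ → ℝ, ∀ x, x₀ t < x →
      HasDerivAt (fun y => curvatureGap u y t) (Zx x) x ∧ ∃ Zxx Zt : ℝ, HasDerivAt Zx Zxx x ∧
      HasDerivWithinAt (fun τ => curvatureGap u x τ) Zt (Icc 0 tb) t ∧
      Zt = Zxx / (1 + uX u x t ^ 2) +
        ((n - 1) * kappa1 u x t ^ 2 + kappaN u x t ^ 2
          - 2 * n * uX u x t ^ 2 / (u x t ^ 2 * (1 + uX u x t ^ 2))) * curvatureGap u x t := by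
  simp only [curvatureGap_eq]
  refine ⟨fun x => -uX (uXX u) x t / √(1 + uX u x t ^ 2) ^ 3
    + 3 * uXX u x t * uX u x t * uXX u x t / √(1 + uX u x t ^ 2) ^ 5
    + uX u x t / (u x t ^ 2 * √(1 + uX u x t ^ 2))
    + uX u x t * uXX u x t / (u x t * √(1 + uX u x t ^ 2) ^ 3), fun x hx => ?_⟩
  have hp : (x, t) ∈ profileDomain tb x₀ := ⟨ht, hx⟩
  have hu := h.pos x t ht hx
  have d0 := h.hasDerivAt_u ht hx
  have d1 := h.hasDerivAt_uX ht hx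
  have d2 := h.hasDerivAt_uX_of_smooth htb (h.contDiffOn_uXX htb) hp
  have d3 := h.hasDerivAt_uX_of_smooth htb (h.contDiffOn_uX htb (h.contDiffOn_uXX htb)) hp
  refine ⟨(hasDerivWithinAt_gap d0.hasDerivWithinAt d1.hasDerivWithinAt d2.hasDerivWithinAt
      hu.ne').hasDerivAt univ_mem, _, _, hasDerivAt_gap_deriv d0 d1 d2 d3 hu.ne' rfl,
    hasDerivWithinAt_gap (h.hasDerivWithinAt_u_time hp) (h.hasDerivWithinAt_uX_time htb hp)
      (h.hasDerivWithinAt_uXX_time htb hp) hu.ne', ?_⟩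
  have hs : √(1 + uX u x t ^ 2) ^ 2 = 1 + uX u x t ^ 2 := Real.sq_sqrt (by positivity)
  rw [kappaN_eq, kappa1]
  exact gap_evolution (by positivity) hu hs

end evolution

section maximum

variable {x t : ℝ}

lemma reaction_le (h : ProfileFlow n tb K x₀ u) (ht : t ∈ Icc 0 tb) (hx : x₀ t < x) :
    (n - 1) * kappa1 u x t ^ 2 + kappaN u x t ^ 2 ≤ n * K ^ 2 := by
  have hn : (2 : ℝ) ≤ n := by exact_mod_cast h.two_le
  have h1 : kappa1 u x t ^ 2 ≤ K ^ 2 :=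
    pow_le_pow_left₀ (h.kappa1_pos ht hx).le (h.kappa1_le x t ht hx) 2
  have h2 : kappaN u x t ^ 2 ≤ K ^ 2 :=
    pow_le_pow_left₀ (h.kappaN_pos ht hx).le (h.kappaN_le x t ht hx) 2
  nlinarith

lemma curvatureGap_le (h : ProfileFlow n tb K x₀ u) (ht : t ∈ Icc 0 tb) (hx : x₀ t < x) :
    curvatureGap u x t ≤ K := by
  have h1 := h.kappa1_pos ht hx
  have h2 := h.kappaN_le x t ht hx
  unfold curvatureGap
  linarith

lemma continuousOn_curvatureGap (h : ProfileFlow n tb K x₀ u) (htb : 0 < tb) :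
    ContinuousOn (fun p : ℝ × ℝ => curvatureGap u p.1 p.2) (profileDomain tb x₀) := by
  have h0 : ContinuousOn (fun p : ℝ × ℝ => u p.1 p.2) (profileDomain tb x₀) :=
    h.smooth.continuousOn
  have h1 : ContinuousOn (fun p : ℝ × ℝ => uX u p.1 p.2) (profileDomain tb x₀) :=
    (h.contDiffOn_uX htb h.smooth).continuousOn
  have h2 : ContinuousOn (fun p : ℝ × ℝ => uXX u p.1 p.2) (profileDomain tb x₀) :=
    (h.contDiffOn_uXX htb).continuousOn
  have hV : ContinuousOn (fun p : ℝ × ℝ => √(1 + uX u p.1 p.2 ^ 2)) (profileDomain tb x₀) :=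
    (continuousOn_const.add (h1.pow 2)).sqrt
  simp only [curvatureGap_eq]
  refine (h2.neg.div (hV.pow 3) fun p _ =>
    pow_ne_zero 3 (Real.sqrt_pos.2 (by positivity)).ne').sub
    (continuousOn_const.div (h0.mul hV) fun p hp => ?_)
  have := h.pos p.1 p.2 hp.1 hp.2
  positivity

lemma continuousOn_penalizedGap (h : ProfileFlow n tb K x₀ u) (htb : 0 < tb) (lam ε : ℝ) :
    ContinuousOn (fun p : ℝ × ℝ => penalizedGap u lam ε p.1 p.2) (profileDomain tb x₀) := by
  have h0 : ContinuousOn (fun p : ℝ × ℝ => u p.1 p.2) (profileDomain tb x₀) :=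
    h.smooth.continuousOn
  have h1 : ContinuousOn (fun p : ℝ × ℝ => 1 / u p.1 p.2) (profileDomain tb x₀) :=
    continuousOn_const.div h0 fun p hp => (h.pos p.1 p.2 hp.1 hp.2).ne'
  have hZ := h.continuousOn_curvatureGap htb
  unfold penalizedGap barrier
  fun_prop

lemma barrier_mul_lt (h : ProfileFlow n tb K x₀ u) {lam ε : ℝ} (hlam : 0 ≤ lam) (hε : 0 < ε)
    (ht : t ∈ Icc 0 tb) (hx : x₀ t < x) (hF : 0 < penalizedGap u lam ε x t) :
    ε * barrier u x t < K := by
  have hu := h.pos x t ht hx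
  have hb : 0 < ε * barrier u x t := by unfold barrier; positivity
  have he : Real.exp (-lam * t) ≤ 1 := Real.exp_le_one_iff.2 (by nlinarith [ht.1])
  have he0 := Real.exp_pos (-lam * t)
  have hZ := h.curvatureGap_le ht hx
  have hF' : ε * barrier u x t < Real.exp (-lam * t) * curvatureGap u x t := by
    unfold penalizedGap at hF; linarith
  have hZ0 : 0 < curvatureGap u x t := pos_of_mul_pos_right (hb.trans hF') he0.le
  nlinarith

lemma isCompact_superlevel (h : ProfileFlow n tb K x₀ u) (htb : 0 < tb) {lam ε m : ℝ}
    (hlam : 0 ≤ lam) (hε : 0 < ε) (hm : 0 < m) :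
    IsCompact {p ∈ profileDomain tb x₀ | m ≤ penalizedGap u lam ε p.1 p.2} := by
  have hK := h.K_pos ⟨le_rfl, htb.le⟩
  set Q := {p ∈ profileDomain tb x₀ | m ≤ penalizedGap u lam ε p.1 p.2} with hQ
  have hb : ∀ p ∈ Q, ε / K ≤ u p.1 p.2 ∧ p.1 ^ 2 ≤ K / ε := by
    intro p hp
    have hu := h.pos p.1 p.2 hp.1.1 hp.1.2
    have := h.barrier_mul_lt hlam hε hp.1.1 hp.1.2 (hm.trans_le hp.2)
    unfold barrier at this
    have h1 : 0 < 1 / u p.1 p.2 := by positivity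
    have h2 := sq_nonneg p.1
    constructor
    · have h3 : ε * (1 / u p.1 p.2) < K := by nlinarith
      rw [div_le_iff₀ hK]
      rw [mul_one_div, div_lt_iff₀ hu] at h3
      linarith
    · rw [le_div_iff₀ hε]; nlinarith
  refine Metric.isCompact_of_isClosed_isBounded (isClosed_of_closure_subset fun p hp => ?_) ?_
  · have := mem_closure_iff_nhdsWithin_neBot.1 hp
    have hpt : p.2 ∈ Icc 0 tb :=
      (isClosed_Icc.preimage continuous_snd).closure_subset_iff.2 (fun q hq => hq.1.1) hp
    obtain ⟨y, hy, hev⟩ := h.exists_eventually_lt hpt (show 0 < ε / K by positivity)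
    have htend : Tendsto Prod.snd (𝓝[Q] p) (𝓝[Icc 0 tb] p.2) :=
      tendsto_nhdsWithin_of_tendsto_nhds_of_eventually_within _
        (continuous_snd.continuousAt.tendsto.mono_left nhdsWithin_le_nhds)
        (eventually_mem_nhdsWithin.mono fun q hq => hq.1.1)
    have hyp : y ≤ p.1 := by
      refine ge_of_tendsto (continuous_fst.continuousAt.tendsto.mono_left
        (nhdsWithin_le_nhds (s := Q))) ?_
      filter_upwards [htend.eventually hev, self_mem_nhdsWithin] with q h1 hq
      exact (h1 q.1 hq.1.2 (hb q hq).1).le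
    have hpD : p ∈ profileDomain tb x₀ := ⟨hpt, hy.trans_le hyp⟩
    refine ⟨hpD, ge_of_tendsto (((h.continuousOn_penalizedGap htb lam ε) p hpD).mono
      (fun q hq => hq.1 : Q ⊆ _)) ?_⟩
    filter_upwards [self_mem_nhdsWithin] with q hq using hq.2
  · refine (((Metric.isBounded_Icc (-√(K / ε)) (√(K / ε))).prod
      (Metric.isBounded_Icc 0 tb))).subset fun p hp => ⟨?_, hp.1.1⟩
    exact abs_le.1 (Real.abs_le_sqrt (hb p hp).2)

lemma penalizedGap_not_max (h : ProfileFlow n tb K x₀ u) (htb : 0 < tb) {ε : ℝ} (hε : 0 < ε)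
    (hp : (x, t) ∈ profileDomain tb x₀) (h0 : t ≠ 0)
    (hF : 0 < penalizedGap u (n * K ^ 2 + 3) ε x t)
    (hmax : ∀ q ∈ profileDomain tb x₀,
      penalizedGap u (n * K ^ 2 + 3) ε q.1 q.2 ≤ penalizedGap u (n * K ^ 2 + 3) ε x t) :
    False := by
  set lam : ℝ := n * K ^ 2 + 3 with hlam
  have hn : (2 : ℝ) ≤ n := by exact_mod_cast h.two_le
  have hu := h.pos x t hp.1 hp.2
  obtain ⟨Zx, hZ⟩ := h.exists_gap_derivs htb hp.1
  obtain ⟨hZx, Zxx, Zt, hZxx, hZt, hev⟩ := hZ x hp.2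
  have hspace : Real.exp (-lam * t) * Zxx
      - ε * (-uXX u x t / u x t ^ 2 + 2 * uX u x t ^ 2 / u x t ^ 3 + 2) ≤ 0 := by
    refine nonpos_of_isLocalMax (f := fun y => penalizedGap u lam ε y t)
      (f₁ := fun y => Real.exp (-lam * t) * Zx y - ε * (-uX u y t / u y t ^ 2 + 2 * y))
      ((eventually_slice hp).mono fun y hy => hmax _ hy) ?_ ?_
    · filter_upwards [eventually_slice hp] with y hy
      refine (((hZ y hy.2).1.const_mul _).sub ((((((hasDerivAt_const y (1 : ℝ)).div
        (h.hasDerivAt_u hy.1 hy.2) (h.pos y t hy.1 hy.2).ne').add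
        (hasDerivAt_pow 2 y)).add_const 1)).const_mul ε)).congr_deriv ?_
      norm_num
    · refine ((hZxx.const_mul _).sub ((((h.hasDerivAt_uX hp.1 hp.2).neg.div
        ((h.hasDerivAt_u hp.1 hp.2).pow 2) (pow_ne_zero 2 hu.ne')).add
        ((hasDerivAt_id x).const_mul 2)).const_mul ε)).congr_deriv ?_
      simp only [Pi.pow_apply, Pi.neg_apply]
      field_simp
      ring
  have htime : 0 ≤ -lam * Real.exp (-lam * t) * curvatureGap u x t + Real.exp (-lam * t) * Zt
      - ε * (-(uXX u x t / (1 + uX u x t ^ 2) - (n - 1) / u x t) / u x t ^ 2) := by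
    refine nonneg_of_isMaxOn_Icc (f := fun τ => penalizedGap u lam ε x τ)
      ((h.eventually_time htb hp).mono fun τ hτ => hmax _ hτ) ?_ hp.1 h0
    have hexp : HasDerivAt (fun τ : ℝ => Real.exp (-lam * τ)) (Real.exp (-lam * t) * -lam) t := by
      simpa using ((hasDerivAt_id t).const_mul (-lam)).exp
    refine ((hexp.hasDerivWithinAt.mul hZt).sub (((((hasDerivWithinAt_const t _ (1 : ℝ)).div
      (h.hasDerivWithinAt_u_time hp) hu.ne').add_const (x ^ 2)).add_const 1).const_mul
      ε)).congr_deriv ?_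
    ring
  have hr := h.reaction_le hp.1 hp.2
  set e := Real.exp (-lam * t)
  have he : 0 < e := Real.exp_pos _
  set W := 1 + uX u x t ^ 2 with hW
  have hW1 : 1 ≤ W := by simp only [hW]; nlinarith [sq_nonneg (uX u x t)]
  have hW0 : 0 < W := by linarith
  set a := uX u x t ^ 2 / (u x t ^ 2 * W) with ha
  have ha0 : 0 ≤ a := by positivity
  set Z := curvatureGap u x t
  set c := (n - 1) * kappa1 u x t ^ 2 + kappaN u x t ^ 2
  have hgap : ε * (1 / u x t + 1) < e * Z := by
    have : ε * x ^ 2 ≥ 0 := by positivity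
    unfold penalizedGap barrier at hF
    nlinarith
  have hbound : 0 ≤ -(lam - c + 2 * n * a) * (e * Z)
      + ε * (2 * (a / u x t) + 2 / W - (n - 1) / u x t ^ 3) := by
    refine htime.trans ?_
    have := div_nonpos_of_nonpos_of_nonneg hspace hW0.le
    rw [hev]
    refine le_of_sub_nonpos (le_trans (le_of_eq ?_) this)
    simp only [ha]
    field_simp
    ring
  have h1 : 2 / W ≤ 2 := by rw [div_le_iff₀ hW0]; linarith
  have h2 : 0 ≤ (n - 1) / u x t ^ 3 := div_nonneg (by linarith) (by positivity)
  have h3 : 3 + 2 * n * a ≤ lam - c + 2 * n * a := by linarith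
  have h4 : (3 + 2 * n * a) * (ε * (1 / u x t + 1)) ≤ (lam - c + 2 * n * a) * (e * Z) :=
    mul_le_mul h3 hgap.le (by positivity) (by nlinarith)
  have h5 : 0 ≤ a / u x t := by positivity
  have h6 : (3 + 2 * n * a) * (1 / u x t + 1) ≤ 2 * (a / u x t) + 2 := by
    refine le_of_mul_le_mul_left ?_ hε
    nlinarith
  have h7 : (3 + 2 * n * a) * (1 / u x t + 1)
      = 3 * (1 / u x t) + 3 + 2 * n * (a / u x t) + 2 * n * a := by ring
  have h8 : 0 < 1 / u x t := by positivity
  nlinarith [mul_nonneg (by linarith : (0 : ℝ) ≤ n) ha0]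

/-- Nonpositivity of the curvature gap is preserved by the flow. -/
theorem curvatureGap_nonpos (h : ProfileFlow n tb K x₀ u) (htb : 0 < tb)
    (h0 : ∀ x, x₀ 0 < x → curvatureGap u x 0 ≤ 0) (ht : t ∈ Icc 0 tb) (hx : x₀ t < x) :
    curvatureGap u x t ≤ 0 := by
  set lam : ℝ := n * K ^ 2 + 3 with hlam
  have hlam0 : 0 ≤ lam := by positivity
  have key : ∀ ε > 0, penalizedGap u lam ε x t ≤ 0 := by
    intro ε hε
    by_contra! hpos
    obtain ⟨p, hp, hmax⟩ := (h.isCompact_superlevel htb hlam0 hε hpos).exists_isMaxOn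
      ⟨(x, t), ⟨ht, hx⟩, le_rfl⟩ ((h.continuousOn_penalizedGap htb lam ε).mono fun q hq => hq.1)
    have hFp : 0 < penalizedGap u lam ε p.1 p.2 := hpos.trans_le hp.2
    refine h.penalizedGap_not_max htb hε hp.1 (fun hp0 => ?_) hFp fun q hq => ?_
    · have hu := h.pos p.1 p.2 hp.1.1 hp.1.2
      have hx0 : x₀ 0 < p.1 := hp0 ▸ hp.1.2
      have hb : 0 ≤ ε * barrier u p.1 p.2 := by unfold barrier; positivity
      have hZ : curvatureGap u p.1 p.2 ≤ 0 := by rw [hp0]; exact h0 p.1 hx0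
      have := mul_nonpos_of_nonneg_of_nonpos (Real.exp_pos (-lam * p.2)).le hZ
      unfold penalizedGap at hFp
      linarith
    · by_cases hq' : penalizedGap u lam ε x t ≤ penalizedGap u lam ε q.1 q.2
      · exact hmax ⟨hq, hq'⟩
      · exact (not_le.1 hq').le.trans hp.2
  have hlim : Tendsto (fun ε : ℝ => penalizedGap u lam ε x t) (𝓝[>] 0)
      (𝓝 (penalizedGap u lam 0 x t)) := by
    have : Continuous fun ε : ℝ => penalizedGap u lam ε x t := by
      unfold penalizedGap; fun_prop
    exact this.continuousWithinAt
  have := le_of_tendsto hlim (eventually_mem_nhdsWithin.mono key)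
  simp only [penalizedGap, zero_mul, sub_zero] at this
  exact nonpos_of_mul_nonpos_right this (Real.exp_pos _)

end maximum

section slice

variable {x t : ℝ}

lemma curvatureGap_eq_neg_div (h : ProfileFlow n tb K x₀ u) (ht : t ∈ Icc 0 tb)
    (hx : x₀ t < x) :
    curvatureGap u x t = -((1 + uX u x t ^ 2 + u x t * uXX u x t)
      / (u x t * √(1 + uX u x t ^ 2) ^ 3)) := by
  have hu := h.pos x t ht hx
  have hs : √(1 + uX u x t ^ 2) ^ 2 = 1 + uX u x t ^ 2 := Real.sq_sqrt (by positivity)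
  have hV : 0 < √(1 + uX u x t ^ 2) := by positivity
  rw [curvatureGap_eq, ← hs, Real.sqrt_sq hV.le]
  field_simp
  ring

lemma curvatureGap_nonpos_iff (h : ProfileFlow n tb K x₀ u) (ht : t ∈ Icc 0 tb)
    (hx : x₀ t < x) :
    curvatureGap u x t ≤ 0 ↔ 0 ≤ 1 + uX u x t ^ 2 + u x t * uXX u x t := by
  have hu := h.pos x t ht hx
  rw [h.curvatureGap_eq_neg_div ht hx, neg_nonpos]
  rw [le_div_iff₀ (by positivity), zero_mul]

lemma hasDerivAt_kappa1 (h : ProfileFlow n tb K x₀ u) (ht : t ∈ Icc 0 tb) (hx : x₀ t < x) :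
    HasDerivAt (fun y => kappa1 u y t) (uX u x t / u x t * curvatureGap u x t) x := by
  have hu := h.pos x t ht hx
  have hV : 0 < √(1 + uX u x t ^ 2) := by positivity
  have hs : √(1 + uX u x t ^ 2) ^ 2 = 1 + uX u x t ^ 2 := Real.sq_sqrt (by positivity)
  have hd := (hasDerivWithinAt_sqrt_one_add_sq
    (h.hasDerivAt_uX ht hx).hasDerivWithinAt (s := univ)).hasDerivAt univ_mem
  refine ((hasDerivAt_const x (1 : ℝ)).div ((h.hasDerivAt_u ht hx).mul hd)
    (mul_pos hu hV).ne').congr_deriv ?_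
  rw [h.curvatureGap_eq_neg_div ht hx]
  simp only [Pi.mul_apply]
  field_simp
  linear_combination (-uX u x t) * hs

lemma antitoneOn_kappa1 (h : ProfileFlow n tb K x₀ u) (ht : t ∈ Icc 0 tb)
    (hZ : ∀ x, x₀ t < x → curvatureGap u x t ≤ 0) :
    AntitoneOn (fun x => kappa1 u x t) (Ioi (x₀ t)) := by
  refine antitoneOn_of_deriv_nonpos (convex_Ioi _)
    (fun x hx => (h.hasDerivAt_kappa1 ht hx).continuousAt.continuousWithinAt)
    (fun x hx => (h.hasDerivAt_kappa1 ht
      (interior_subset hx)).differentiableAt.differentiableWithinAt) fun x hx => ?_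
  rw [interior_Ioi] at hx
  rw [(h.hasDerivAt_kappa1 ht hx).deriv]
  exact mul_nonpos_of_nonneg_of_nonpos
    (div_pos (h.ux_pos x t ht hx) (h.pos x t ht hx)).le (hZ x hx)

end slice

end ProfileFlow

/-- Under the hypotheses of the preceding lemma with `C = 1`: if `ℜ ≤ 1`
initially, then `ℜ ≤ 1` for all `t ∈ [0, t̄]`; moreover `1 + u_x² + u·u_xx ≥ 0`, so that
`∂_x(1/κ₁) = u_x(1+u_x²)^{−1/2}(1+u_x²+u·u_xx) ≥ 0`, each principal curvature achieves its
maximum at the tip (`κ₁` is antitone in `x` and `κ_n ≤ κ₁`), i.e. the maximum curvature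
`sup_{Γ_t}|h|` occurs at the tip of the hypersurface. -/
theorem ratio_one_preserved_max_curvature_at_tip
    (n : ℕ) (hn : 2 ≤ n) (tb T : ℝ) (htb : 0 ≤ tb) (htT : tb < T)
    (x₀ : ℝ → ℝ) (u : ℝ → ℝ → ℝ)
    (hsmooth : ContDiffOn ℝ (⊤ : ℕ∞) (Function.uncurry u)
      {p : ℝ × ℝ | p.2 ∈ Icc 0 tb ∧ x₀ p.2 < p.1})
    (hpos : ∀ x t : ℝ, t ∈ Icc 0 tb → x₀ t < x → 0 < u x t)
    (htip : ∀ t ∈ Icc 0 tb, u (x₀ t) t = 0)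
    (htipcont : ∀ t ∈ Icc 0 tb, Tendsto (fun x => u x t) (𝓝[>] (x₀ t)) (𝓝 0))
    (hux : ∀ x t : ℝ, t ∈ Icc 0 tb → x₀ t < x → 0 < uX u x t)
    (huxx : ∀ x t : ℝ, t ∈ Icc 0 tb → x₀ t < x → uXX u x t < 0)
    (hPDE : ∀ x t : ℝ, t ∈ Icc 0 tb → x₀ t < x →
      uT u x t = uXX u x t / (1 + (uX u x t) ^ 2) - ((n : ℝ) - 1) / u x t)
    (hcurvbound : ∃ K : ℝ, ∀ x t : ℝ, t ∈ Icc 0 tb → x₀ t < x →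
      kappa1 u x t ≤ K ∧ kappaN u x t ≤ K)
    (hRtip : ∀ t ∈ Icc 0 tb, Tendsto (fun x => ratioR u x t) (𝓝[>] (x₀ t)) (𝓝 1))
    (hinit : ∀ x : ℝ, x₀ 0 < x → ratioR u x 0 ≤ 1) :
    ∀ t ∈ Icc 0 tb,
      (∀ x : ℝ, x₀ t < x → ratioR u x t ≤ 1) ∧
      (∀ x : ℝ, x₀ t < x → 0 ≤ 1 + (uX u x t) ^ 2 + u x t * uXX u x t) ∧
      (∀ x : ℝ, x₀ t < x →
        0 ≤ uX u x t * (1 + (uX u x t) ^ 2) ^ (-(1 : ℝ) / 2) *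
          (1 + (uX u x t) ^ 2 + u x t * uXX u x t)) ∧
      AntitoneOn (fun x => kappa1 u x t) (Ioi (x₀ t)) ∧
      (∀ x : ℝ, x₀ t < x → kappaN u x t ≤ kappa1 u x t) := by
  obtain ⟨K, hK⟩ := hcurvbound
  have h : ProfileFlow n tb K x₀ u := ⟨hn, hsmooth, hpos, htipcont, hux, huxx, hPDE,
    fun x t ht hx => (hK x t ht hx).1, fun x t ht hx => (hK x t ht hx).2⟩
  have hZ0 : ∀ x, x₀ 0 < x → curvatureGap u x 0 ≤ 0 := fun x hx =>
    (h.curvatureGap_nonpos_iff ⟨le_rfl, htb⟩ hx).2 ((ratioR_le_one_iff u x 0).1 (hinit x hx))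
  intro t ht
  have hZ : ∀ x, x₀ t < x → curvatureGap u x t ≤ 0 := by
    rcases htb.eq_or_lt with h0 | h0
    · obtain rfl : t = 0 := le_antisymm (h0 ▸ ht.2) ht.1
      exact hZ0
    · exact fun x hx => h.curvatureGap_nonpos h0 hZ0 ht hx
  have hA : ∀ x, x₀ t < x → 0 ≤ 1 + uX u x t ^ 2 + u x t * uXX u x t := fun x hx =>
    (h.curvatureGap_nonpos_iff ht hx).1 (hZ x hx)
  exact ⟨fun x hx => (ratioR_le_one_iff u x t).2 (hA x hx), hA,
    fun x hx => mul_nonneg (mul_nonneg (hux x t ht hx).le (by positivity)) (hA x hx),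
    h.antitoneOn_kappa1 ht hZ, fun x hx => sub_nonpos.1 (hZ x hx)⟩
end

section
/- Let n ≥ 2 be an integer and a > 0, and let P be the bowl soliton profile. Let q : (0,∞) × ℝ → ℝ be a smooth solution of ∂_s q = ∂_z( q_z/(1+q²) + (n−1)·q/z ). Suppose there exist constants 0 < c⁻ ≤ c⁺ such that c⁻·z ≤ q(z,s) ≤ c⁺·z for all z > 0 and s ∈ ℝ, and that q(z,s)/z → a/(n−1) as z → ∞, uniformly in s. Then q(z,s) = P'(a·z) for all z > 0 and s ∈ ℝ. -/
open Filter Topology Set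

theorem hasDerivAt_nonpos_of_left_nonneg {f : ℝ → ℝ} {d x₀ x : ℝ} (hx : x₀ < x)
    (hf : HasDerivAt f d x) (hpos : ∀ t ∈ Ico x₀ x, 0 ≤ f t) (h0 : f x ≤ 0) : d ≤ 0 := by
  have hs := (hasDerivAt_iff_tendsto_slope_left_right.mp hf).1
  refine le_of_tendsto hs ?_
  filter_upwards [Ico_mem_nhdsLT hx] with t ht
  rw [slope_def_field]
  exact div_nonpos_of_nonneg_of_nonpos (by linarith [hpos t ht]) (by linarith [ht.2]) 

theorem neg_of_deriv_neg_at_zeros {f : ℝ → ℝ} (hc : Continuous f) (h0 : f 0 < 0)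
    (hd : ∀ x, 0 < x → f x = 0 → ∃ d < 0, HasDerivAt f d x) {x : ℝ} (hx : 0 ≤ x) : f x < 0 := by
  by_contra! hfx
  have hK : IsCompact (Icc 0 x ∩ {t | 0 ≤ f t}) :=
    isCompact_Icc.inter_right (isClosed_le continuous_const hc)
  obtain ⟨t, ⟨⟨ht0, htx⟩, hft⟩, hmin⟩ :=
    hK.exists_isMinOn ⟨x, ⟨hx, le_rfl⟩, hfx⟩ continuousOn_id
  simp only [mem_ofPred_eq] at hft
  have htpos : 0 < t := ht0.lt_of_ne (by rintro rfl; linarith)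
  have hbefore : ∀ r ∈ Ico 0 t, f r < 0 := by
    intro r hr
    by_contra! hfr
    have : t ≤ r := hmin ⟨⟨hr.1, hr.2.le.trans htx⟩, hfr⟩
    linarith [hr.2]
  have hle : f t ≤ 0 := by
    refine le_of_tendsto (hc.tendsto t |>.mono_left nhdsWithin_le_nhds : Tendsto f (𝓝[<] t) _) ?_
    filter_upwards [Ico_mem_nhdsLT htpos] with r hr using (hbefore r hr).le
  obtain ⟨d, hdneg, hder⟩ := hd t htpos (le_antisymm hle hft)
  have := hasDerivAt_nonpos_of_left_nonneg htpos hder.neg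
    (fun r hr => by simpa using (hbefore r hr).le) (by simpa using hft)
  linarith

theorem second_deriv_nonneg_of_isLocalMin {D D' : ℝ → ℝ} {e x : ℝ} (hmin : IsLocalMin D x)
    (hD : ∀ᶠ t in 𝓝 x, HasDerivAt D (D' t) t) (hD' : HasDerivAt D' e x) : 0 ≤ e := by
  by_contra! he
  have hev : deriv D =ᶠ[𝓝 x] D' := hD.mono fun t ht => ht.deriv
  have hdd : deriv (deriv D) x = e := by rw [hev.deriv_eq, hD'.deriv]
  have hmax : IsLocalMax D x :=
    isLocalMax_of_deriv_deriv_neg (by rwa [hdd]) hmin.deriv_eq_zero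
      hD.self_of_nhds.continuousAt
  have hconst : D =ᶠ[𝓝 x] fun _ => D x := by
    filter_upwards [hmin, hmax] with t h1 h2 using le_antisymm h2 h1
  have : deriv (deriv D) x = 0 := by
    rw [hconst.deriv.deriv_eq]; simp
  linarith

/-- The flux `f'/(1+f²) + m f/z` of the equation. -/
noncomputable def flux (m : ℝ) (f : ℝ → ℝ) (z : ℝ) : ℝ :=
  deriv f z / (1 + f z ^ 2) + m * f z / z

theorem flux_deriv_le_of_touching {m z Fu Fv : ℝ} {u v : ℝ → ℝ} (hz : 0 < z)
    (hu : ∀ᶠ t in 𝓝 z, DifferentiableAt ℝ u t) (hv : ∀ᶠ t in 𝓝 z, DifferentiableAt ℝ v t)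
    (hle : ∀ᶠ t in 𝓝 z, u t ≤ v t) (heq : u z = v z)
    (hFu : HasDerivAt (flux m u) Fu z) (hFv : HasDerivAt (flux m v) Fv z) : Fu ≤ Fv := by
  have hmin : IsLocalMin (fun t => v t - u t) z := by
    filter_upwards [hle] with t ht
    linarith
  have hd : HasDerivAt (fun t => v t - u t) 0 z := by
    have h := hv.self_of_nhds.hasDerivAt.sub hu.self_of_nhds.hasDerivAt
    have h0 := hmin.hasDerivAt_eq_zero h
    rw [h0] at h
    exact h
  have hmin' : IsLocalMin (fun t => Real.arctan (v t) - Real.arctan (u t)) z := by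
    filter_upwards [hle] with t ht
    have := Real.arctan_strictMono.monotone ht
    have h0 : Real.arctan (v z) - Real.arctan (u z) = 0 := by rw [heq, sub_self]
    show Real.arctan (v z) - Real.arctan (u z) ≤ Real.arctan (v t) - Real.arctan (u t)
    linarith
  have hquot : HasDerivAt (fun t => m * ((v t - u t) / t)) 0 z := by
    have := (hd.div (hasDerivAt_id z) hz.ne').const_mul m
    simpa [heq] using this
  have h := second_deriv_nonneg_of_isLocalMin (x := z)
    (D' := fun t => flux m v t - flux m u t - m * ((v t - u t) / t)) hmin' ?_
    ((hFv.sub hFu).sub hquot)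
  · linarith
  · filter_upwards [hu, hv] with t htu htv
    refine (htv.hasDerivAt.arctan.sub htu.hasDerivAt.arctan).congr_deriv ?_
    simp only [flux]
    ring

/-- Parabolic comparison for `∂_s u = ∂_z (flux m u)` on a compact rectangle. -/
theorem lt_of_strict_supersolution {m δ Z s₀ s₁ : ℝ} (hδ : 0 < δ) {u v : ℝ → ℝ → ℝ}
    (hu : ContinuousOn (Function.uncurry u) (Icc δ Z ×ˢ Icc s₀ s₁))
    (hv : ContinuousOn (Function.uncurry v) (Icc δ Z ×ˢ Icc s₀ s₁))
    (hinit : ∀ z ∈ Icc δ Z, u z s₀ < v z s₀)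
    (hleft : ∀ s ∈ Icc s₀ s₁, u δ s < v δ s) (hright : ∀ s ∈ Icc s₀ s₁, u Z s < v Z s)
    (hdu : ∀ s, ∀ z ∈ Ioo δ Z, DifferentiableAt ℝ (fun z' => u z' s) z)
    (hdv : ∀ s, ∀ z ∈ Ioo δ Z, DifferentiableAt ℝ (fun z' => v z' s) z)
    (hstrict : ∀ z ∈ Ioo δ Z, ∀ s ∈ Ioc s₀ s₁, ∃ us vs Fu Fv : ℝ,
      HasDerivAt (u z) us s ∧ HasDerivAt (v z) vs s ∧
      HasDerivAt (flux m fun z' => u z' s) Fu z ∧ HasDerivAt (flux m fun z' => v z' s) Fv z ∧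
      us - Fu < vs - Fv) :
    ∀ z ∈ Icc δ Z, ∀ s ∈ Icc s₀ s₁, u z s < v z s := by
  intro z₁ hz₁ s hs
  by_contra! hcon
  have hcl : IsCompact {p ∈ Icc δ Z ×ˢ Icc s₀ s₁ | Function.uncurry v p ≤ Function.uncurry u p} :=
    (isCompact_Icc.prod isCompact_Icc).of_isClosed_subset
      ((isClosed_Icc.prod isClosed_Icc).isClosed_le hv hu) (sep_subset _ _)
  obtain ⟨⟨z, t⟩, ⟨⟨hz, ht⟩, hzt⟩, hmin⟩ :=
    hcl.exists_isMinOn ⟨(z₁, s), ⟨hz₁, hs⟩, hcon⟩ continuousOn_snd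
  simp only [Function.uncurry_apply_pair] at hzt hz ht
  have hbefore : ∀ z' ∈ Icc δ Z, ∀ r ∈ Ico s₀ t, u z' r < v z' r := by
    intro z' hz' r hr
    by_contra! hc
    have : t ≤ r := hmin (show (z', r) ∈ _ from ⟨⟨hz', hr.1, hr.2.le.trans ht.2⟩, hc⟩)
    linarith [hr.2]
  have ht0 : s₀ < t := ht.1.lt_of_ne (by rintro rfl; linarith [hinit z hz])
  have hzδ : δ < z := hz.1.lt_of_ne (by rintro rfl; linarith [hleft t ht])
  have hzZ : z < Z := hz.2.lt_of_ne (by rintro rfl; linarith [hright t ht])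
  have hnow : ∀ z' ∈ Icc δ Z, u z' t ≤ v z' t := by
    intro z' hz'
    have hmaps : MapsTo (fun r => (z', r)) (Ico s₀ t) (Icc δ Z ×ˢ Icc s₀ s₁) :=
      fun r hr => ⟨hz', hr.1, hr.2.le.trans ht.2⟩
    have hne : (𝓝[Ico s₀ t] t).NeBot := by
      rw [← mem_closure_iff_nhdsWithin_neBot, closure_Ico ht0.ne]
      exact ⟨ht0.le, le_rfl⟩
    have hpath : Tendsto (fun r => (z', r)) (𝓝[Ico s₀ t] t)
        (𝓝[Icc δ Z ×ˢ Icc s₀ s₁] (z', t)) :=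
      tendsto_nhdsWithin_iff.mpr ⟨(Continuous.prodMk_right z').continuousAt.tendsto.mono_left
        nhdsWithin_le_nhds, eventually_mem_nhdsWithin.mono hmaps⟩
    exact le_of_tendsto_of_tendsto ((hu (z', t) ⟨hz', ht⟩).tendsto.comp hpath)
      ((hv (z', t) ⟨hz', ht⟩).tendsto.comp hpath)
      (eventually_mem_nhdsWithin.mono fun r hr => (hbefore z' hz' r hr).le)
  obtain ⟨us, vs, Fu, Fv, hus, hvs, hFu, hFv, hlt⟩ := hstrict z ⟨hzδ, hzZ⟩ t ⟨ht0, ht.2⟩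
  have htime : vs - us ≤ 0 := hasDerivAt_nonpos_of_left_nonneg ht0 (hvs.sub hus)
    (fun r hr => by simpa using (hbefore z hz r hr).le) (by simpa using hzt)
  have hmem : Ioo δ Z ∈ 𝓝 z := Ioo_mem_nhds hzδ hzZ
  have hspace : Fu ≤ Fv := flux_deriv_le_of_touching (hδ.trans hzδ)
    (eventually_of_mem hmem (hdu t)) (eventually_of_mem hmem (hdv t))
    (eventually_of_mem hmem fun z' hz' => hnow z' (Ioo_subset_Icc_self hz'))
    (le_antisymm (hnow z hz) hzt) hFu hFv
  linarith

/-- `y` is the slope `P'` of the bowl soliton profile in dimension `N`, with derivative `y'`. -/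
structure IsBowlSlope (N : ℝ) (y y' : ℝ → ℝ) : Prop where
  two_le : 2 ≤ N
  continuous_deriv : Continuous y'
  hasDerivAt : ∀ w, HasDerivAt y (y' w) w
  map_zero : y 0 = 0
  ode : ∀ w, 0 < w → y' w / (1 + y w ^ 2) + (N - 1) * y w / w = 1

/-- The curvature `y'/(1+y²)` of the profile curve, up to a factor. -/
noncomputable def bend (y y' : ℝ → ℝ) (w : ℝ) : ℝ := y' w / (1 + y w ^ 2)

/-- The logarithmic decay rate `-w * d/dw` of `bend`, expressed through the equation. -/
noncomputable def bendDecay (N : ℝ) (y y' : ℝ → ℝ) (w : ℝ) : ℝ :=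
  (N - 1) * (1 + y w ^ 2) * bend y y' w + bend y y' w - 1

theorem bowl_quintic_pos {r : ℝ} (hr0 : 0 < r) (hr1 : r ≤ 1) :
    0 < 64 - 160 * r + 72 * r ^ 2 + 92 * r ^ 3 - 54 * r ^ 4 - 9 * r ^ 5 := by
  have h5 : r ^ 5 ≤ r ^ 4 := pow_le_pow_of_le_one hr0.le hr1 (by norm_num)
  have h1 : 0 ≤ 1 - r := by linarith
  nlinarith [mul_nonneg (mul_nonneg hr0.le h1) (sq_nonneg (r - 77 / 100)),
    sq_nonneg (r - 77 / 100), mul_nonneg hr0.le (sq_nonneg (r - 77 / 100)),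
    mul_nonneg h1 (sq_nonneg (r - 77 / 100)), sq_nonneg (r ^ 2 - (77 / 100) ^ 2),
    sq_nonneg (r * (r - 77 / 100)), mul_nonneg hr0.le h1]

theorem bowl_barrier_ineq {r h : ℝ} (hr0 : 0 < r) (hr1 : r ≤ 1) (hhr : h ≤ r / 2) :
    2 * h * (2 - 3 / 4 * r ^ 2 - h) * (2 - 3 / 4 * r ^ 2 - r) <
      (1 - 3 / 4 * r ^ 2) * (1 - h) * (2 + 3 / 4 * r ^ 2) := by
  have hquint := bowl_quintic_pos hr0 hr1
  have hsq : r ^ 2 ≤ 1 := pow_le_one₀ hr0.le hr1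
  have hmono : 0 ≤ (r / 2 - h) * ((1 - 3 / 4 * r ^ 2) * (2 + 3 / 4 * r ^ 2) +
      2 * (2 - 3 / 4 * r ^ 2 - r) * (2 - 3 / 4 * r ^ 2 - h - r / 2)) := by
    refine mul_nonneg (by linarith) (add_nonneg ?_ ?_)
    · exact mul_nonneg (by linarith) (by positivity)
    · exact mul_nonneg (by linarith) (by linarith)
  linarith

namespace IsBowlSlope

variable {N : ℝ} {y y' : ℝ → ℝ}

theorem continuous (H : IsBowlSlope N y y') : Continuous y :=
  continuous_iff_continuousAt.mpr fun w => (H.hasDerivAt w).continuousAt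

theorem continuous_bend (H : IsBowlSlope N y y') : Continuous (bend y y') :=
  H.continuous_deriv.div (by have := H.continuous; fun_prop) fun w => by positivity

theorem continuous_bendDecay (H : IsBowlSlope N y y') : Continuous (bendDecay N y y') := by
  have := H.continuous
  have := H.continuous_bend
  unfold bendDecay
  fun_prop

theorem deriv_eq (_H : IsBowlSlope N y y') (w : ℝ) : y' w = (1 + y w ^ 2) * bend y y' w := by
  unfold bend
  field_simp

theorem mul_eq (H : IsBowlSlope N y y') {w : ℝ} (hw : 0 < w) :
    (N - 1) * y w = (1 - bend y y' w) * w := by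
  have := H.ode w hw
  rw [← bend] at this
  field_simp at this ⊢
  linarith

theorem bend_zero (H : IsBowlSlope N y y') : bend y y' 0 = 1 / N := by
  have hN := H.two_le
  have hslope : Tendsto (fun w => y w / w) (𝓝[>] 0) (𝓝 (y' 0)) := by
    have := (hasDerivAt_iff_tendsto_slope_left_right.mp (H.hasDerivAt 0)).2
    refine this.congr fun w => ?_
    rw [slope_def_field, H.map_zero, sub_zero, sub_zero]
  have hb : Tendsto (bend y y') (𝓝[>] 0) (𝓝 (bend y y' 0)) :=
    (H.continuous_bend.tendsto 0).mono_left nhdsWithin_le_nhds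
  have hsum := hb.add (hslope.const_mul (N - 1))
  have hone : Tendsto (fun w => bend y y' w + (N - 1) * (y w / w)) (𝓝[>] 0) (𝓝 1) := by
    refine tendsto_const_nhds.congr' ?_
    filter_upwards [self_mem_nhdsWithin] with w hw
    have h := H.ode w hw
    rw [mul_div_assoc] at h
    exact h.symm
  have heq := tendsto_nhds_unique hsum hone
  rw [H.deriv_eq 0, H.map_zero] at heq
  field_simp
  linarith

theorem hasDerivAt_bend (H : IsBowlSlope N y y') {w : ℝ} (hw : 0 < w) :
    HasDerivAt (bend y y') (-bendDecay N y y' w / w) w := by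
  have h1 : HasDerivAt (fun t => 1 - (N - 1) * y t / t)
      (((N - 1) * y w - (N - 1) * y' w * w) / w ^ 2) w := by
    have := (((H.hasDerivAt w).const_mul (N - 1)).div (hasDerivAt_id w) hw.ne').const_sub 1
    exact this.congr_deriv (by simp only [id]; ring)
  have h2 : (bend y y') =ᶠ[𝓝 w] fun t => 1 - (N - 1) * y t / t := by
    filter_upwards [lt_mem_nhds hw] with t ht
    have := H.ode t ht
    rw [bend]
    linarith
  have h3 := h1.congr_of_eventuallyEq h2
  rw [H.mul_eq hw, H.deriv_eq] at h3
  have h4 : -bendDecay N y y' w / w =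
      ((1 - bend y y' w) * w - (N - 1) * ((1 + y w ^ 2) * bend y y' w) * w) / w ^ 2 := by
    rw [bendDecay]
    field_simp
    ring
  rwa [h4]

theorem bend_pos (H : IsBowlSlope N y y') {w : ℝ} (hw : 0 ≤ w) : 0 < bend y y' w := by
  have hN := H.two_le
  have := neg_of_deriv_neg_at_zeros (f := fun w => -bend y y' w) H.continuous_bend.neg
    (by rw [H.bend_zero, neg_lt_zero]; positivity)
    (fun x hx h0 => ⟨_, ?_, (H.hasDerivAt_bend hx).neg⟩) hw
  · linarith
  · have : bend y y' x = 0 := by linarith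
    rw [bendDecay, this]
    simpa [neg_div] using hx

theorem bend_le (H : IsBowlSlope N y y') {w : ℝ} (hw : 0 ≤ w) : bend y y' w ≤ 1 / N := by
  have hN := H.two_le
  refine le_of_forall_pos_lt_add fun ε hε => ?_
  have := neg_of_deriv_neg_at_zeros (f := fun w => bend y y' w - (1 / N + ε))
    (H.continuous_bend.sub continuous_const) (by rw [H.bend_zero]; linarith)
    (fun x hx h0 => ⟨_, ?_, (H.hasDerivAt_bend hx).sub_const _⟩) hw
  · linarith
  · have hb : N * bend y y' x = 1 + N * ε := by
      rw [sub_eq_zero.mp h0]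
      field_simp
    refine div_neg_of_neg_of_pos ?_ hx
    have h2 : 0 ≤ (N - 1) * (y x ^ 2 * bend y y' x) :=
      mul_nonneg (by linarith) (mul_nonneg (sq_nonneg _) (H.bend_pos hx.le).le)
    rw [bendDecay]
    nlinarith [mul_pos (show 0 < N by linarith) hε]

theorem div_le_slope (H : IsBowlSlope N y y') {w : ℝ} (hw : 0 < w) : w / N ≤ y w := by
  have hN := H.two_le
  have h1 := H.mul_eq hw
  have h2 := H.bend_le hw.le
  have h3 : (N - 1) * (w / N) ≤ (N - 1) * y w := by
    rw [h1]
    have : (N - 1) * (w / N) = (1 - 1 / N) * w := by field_simp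
    rw [this]
    gcongr
  exact le_of_mul_le_mul_left h3 (by linarith)

theorem slope_le_div (H : IsBowlSlope N y y') {w : ℝ} (hw : 0 < w) : y w ≤ w / (N - 1) := by
  have hN := H.two_le
  rw [le_div_iff₀' (by linarith), H.mul_eq hw]
  nlinarith [mul_pos (H.bend_pos hw.le) hw]

theorem monotoneOn (H : IsBowlSlope N y y') : MonotoneOn y (Ici 0) := by
  refine monotoneOn_of_deriv_nonneg (convex_Ici 0) H.continuous.continuousOn
    (fun w _ => (H.hasDerivAt w).differentiableAt.differentiableWithinAt) fun w hw => ?_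
  rw [interior_Ici, mem_Ioi] at hw
  rw [(H.hasDerivAt w).deriv, H.deriv_eq]
  exact mul_nonneg (by positivity) (H.bend_pos hw.le).le

theorem bendDecay_lt (H : IsBowlSlope N y y') {w : ℝ} (hw : 0 ≤ w) :
    bendDecay N y y' w < 1 - 3 / 4 * (N * bend y y' w) ^ 2 := by
  have hN := H.two_le
  have hcont : Continuous fun w => bendDecay N y y' w - (1 - 3 / 4 * (N * bend y y' w) ^ 2) := by
    have := H.continuous_bend
    have := H.continuous_bendDecay
    fun_prop
  refine sub_neg.mp (neg_of_deriv_neg_at_zeros hcont ?_ (fun x hx h0 => ?_) hw)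
  · rw [bendDecay, H.bend_zero, H.map_zero]
    field_simp
    linarith
  have hb := H.hasDerivAt_bend hx
  have hX : HasDerivAt (bendDecay N y y') ((N - 1) * (2 * y x * y' x) * bend y y' x +
      (N - 1) * (1 + y x ^ 2) * (-bendDecay N y y' x / x) + -bendDecay N y y' x / x) x := by
    have := ((((((H.hasDerivAt x).pow 2).const_add 1).const_mul (N - 1)).mul hb).add hb).sub_const 1
    exact this.congr_deriv (by simp)
  refine ⟨_, ?_, hX.sub ((((hb.const_mul N).pow 2).const_mul (3 / 4)).const_sub 1)⟩
  have hmul := H.mul_eq hx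
  have hbpos := H.bend_pos hx.le
  have hble := H.bend_le hx.le
  have hdef : bendDecay N y y' x =
    (N - 1) * (1 + y x ^ 2) * bend y y' x + bend y y' x - 1 := rfl
  have hx0 : bendDecay N y y' x = 1 - 3 / 4 * (N * bend y y' x) ^ 2 := sub_eq_zero.mp h0
  rw [H.deriv_eq x]
  clear h0 hX hb
  generalize bendDecay N y y' x = X at *
  generalize bend y y' x = h at *
  generalize y x = Y at *
  rw [le_div_iff₀ (by linarith)] at hble
  have hineq := bowl_barrier_ineq (r := N * h) (h := h) (by positivity) (by linarith) (by nlinarith)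
  have h1 : 0 < 1 - h := by nlinarith
  have hYY : (N - 1) * Y ^ 2 * h = 1 + X - N * h := by linarith
  have hYx : (1 - h) * (x * Y) = (N - 1) * Y ^ 2 := by linear_combination -Y * hmul
  rw [← sub_pos] at hineq
  have hval : (1 - h) * h * x * ((N - 1) * (2 * Y * ((1 + Y ^ 2) * h)) * h +
      (N - 1) * (1 + Y ^ 2) * (-X / x) + -X / x -
        -(3 / 4 * (((2 : ℕ) : ℝ) * (N * h) ^ (2 - 1) * (N * (-X / x))))) =
      -((1 - 3 / 4 * (N * h) ^ 2) * (1 - h) * (2 + 3 / 4 * (N * h) ^ 2) -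
        2 * h * (2 - 3 / 4 * (N * h) ^ 2 - h) * (2 - 3 / 4 * (N * h) ^ 2 - N * h)) := by
    have hS : (N - 1) * (1 + Y ^ 2) * h = 1 + X - h := by linarith
    have e : (1 - h) * h * x * ((N - 1) * (2 * Y * ((1 + Y ^ 2) * h)) * h +
      (N - 1) * (1 + Y ^ 2) * (-X / x) + -X / x -
        -(3 / 4 * (((2 : ℕ) : ℝ) * (N * h) ^ (2 - 1) * (N * (-X / x))))) =
        2 * h * (((N - 1) * (1 + Y ^ 2) * h) * (((1 - h) * (x * Y)) * h)) -
        (1 - h) * X * ((N - 1) * (1 + Y ^ 2) * h + h + 3 / 2 * (N * h) ^ 2) := by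
      field_simp
      norm_num
      ring
    rw [e, hYx, hS, hYY, hx0]
    ring
  have hneg := hval.trans_lt (neg_neg_of_pos hineq)
  exact neg_of_mul_neg_right hneg (by positivity)

theorem slope_div_tendsto (H : IsBowlSlope N y y') :
    Tendsto (fun w => y w / w) atTop (𝓝 (1 / (N - 1))) := by
  have hN := H.two_le
  have hb : Tendsto (bend y y') atTop (𝓝 0) := by
    have hlim : Tendsto (fun w : ℝ => 2 / (w / N) ^ 2) atTop (𝓝 0) :=
      tendsto_const_nhds.div_atTop
        ((tendsto_pow_atTop two_ne_zero).comp (tendsto_id.atTop_div_const (by linarith)))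
    refine tendsto_of_tendsto_of_tendsto_of_le_of_le' tendsto_const_nhds hlim ?_ ?_
    · filter_upwards [eventually_ge_atTop 0] with w hw using (H.bend_pos hw).le
    · filter_upwards [eventually_gt_atTop 0] with w hw
      have h1 := H.bendDecay_lt hw.le
      rw [bendDecay] at h1
      have h2 := H.bend_pos hw.le
      have h3 : (w / N) ^ 2 ≤ y w ^ 2 := by
        gcongr
        exact H.div_le_slope hw
      have h4 : 0 < (w / N) ^ 2 := by positivity
      rw [le_div_iff₀ h4]
      have h5 : bend y y' w * (w / N) ^ 2 ≤ bend y y' w * y w ^ 2 := by gcongr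
      have h6 : 0 ≤ (N - 2) * ((1 + y w ^ 2) * bend y y' w) :=
        mul_nonneg (by linarith) (by positivity)
      nlinarith [sq_nonneg (N * bend y y' w)]
  have := (hb.const_sub 1).div_const (N - 1)
  rw [sub_zero] at this
  refine this.congr' ?_
  filter_upwards [eventually_gt_atTop 0] with w hw
  have h1 := H.mul_eq hw
  have : N - 1 ≠ 0 := by linarith
  field_simp
  linarith

end IsBowlSlope

/-- `q` solves `∂_s q = ∂_z (flux m q)` classically on `(0,∞) × ℝ`. -/
structure IsFluxSolution (m : ℝ) (q : ℝ → ℝ → ℝ) : Prop where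
  continuousOn : ContinuousOn (Function.uncurry q) {p : ℝ × ℝ | 0 < p.1}
  differentiableAt : ∀ z s, 0 < z → DifferentiableAt ℝ (fun z' => q z' s) z
  hasDerivAt : ∀ z s, 0 < z →
    ∃ d, HasDerivAt (q z) d s ∧ HasDerivAt (flux m fun z' => q z' s) d z

/-- The argument of the soliton slope in the barriers: a power perturbation of `lam * z`,
normalized to agree with it at `z = Z`. -/
noncomputable def barrierArg (Z κ lam z : ℝ) : ℝ := lam * z * (z / Z) ^ κ

/-- The parameter of the barriers, moving exponentially in time and equal to `lam` at time `s₁`. -/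
noncomputable def barrierParam (lam ρ s₁ s : ℝ) : ℝ := lam * Real.exp (ρ * (s - s₁))

theorem barrierArg_pos {Z κ lam z : ℝ} (hZ : 0 < Z) (hlam : 0 < lam) (hz : 0 < z) :
    0 < barrierArg Z κ lam z := by
  unfold barrierArg
  positivity

theorem barrierArg_self {Z : ℝ} (hZ : 0 < Z) (κ lam : ℝ) : barrierArg Z κ lam Z = lam * Z := by
  rw [barrierArg, div_self hZ.ne', Real.one_rpow, mul_one]

theorem hasDerivAt_barrierArg {Z κ lam z : ℝ} (hZ : 0 < Z) (hz : 0 < z) :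
    HasDerivAt (barrierArg Z κ lam) ((1 + κ) * barrierArg Z κ lam z / z) z := by
  have h1 : HasDerivAt (fun t => (t / Z) ^ κ) (1 / Z * κ * (z / Z) ^ (κ - 1)) z :=
    ((hasDerivAt_id z).div_const Z).rpow_const (Or.inl (by simp only [id]; positivity))
  refine (((hasDerivAt_id z).const_mul lam).mul h1).congr_deriv ?_
  rw [Real.rpow_sub_one (by positivity), barrierArg]
  simp only [id]
  field_simp

theorem barrierParam_pos {lam : ℝ} (hlam : 0 < lam) (ρ s₁ s : ℝ) :
    0 < barrierParam lam ρ s₁ s := by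
  unfold barrierParam
  positivity

theorem barrierParam_self (lam ρ s₁ : ℝ) : barrierParam lam ρ s₁ s₁ = lam := by
  simp [barrierParam]

theorem barrierParam_start {lam lam₀ ρ : ℝ} (hlam : 0 < lam) (hlam₀ : 0 < lam₀) (hρ : ρ ≠ 0)
    (s₁ : ℝ) : barrierParam lam ρ s₁ (s₁ + Real.log (lam₀ / lam) / ρ) = lam₀ := by
  rw [barrierParam, add_sub_cancel_left, mul_div_cancel₀ _ hρ, Real.exp_log (by positivity)]
  field_simp

theorem hasDerivAt_barrierArg_param (Z κ lam ρ s₁ z s : ℝ) :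
    HasDerivAt (fun t => barrierArg Z κ (barrierParam lam ρ s₁ t) z)
      (ρ * barrierArg Z κ (barrierParam lam ρ s₁ s) z) s := by
  have h := (((((hasDerivAt_id s).sub_const s₁).const_mul ρ).exp.const_mul lam).mul_const
    z).mul_const ((z / Z) ^ κ)
  refine h.congr_deriv ?_
  simp only [barrierArg, barrierParam, id]
  ring

theorem continuousOn_barrierArg {Z : ℝ} (hZ : 0 < Z) (κ lam ρ s₁ : ℝ) :
    ContinuousOn (fun p : ℝ × ℝ => barrierArg Z κ (barrierParam lam ρ s₁ p.2) p.1)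
      {p | 0 < p.1} := by
  unfold barrierArg barrierParam
  refine ContinuousOn.mul (by fun_prop) (ContinuousOn.rpow_const (by fun_prop) fun p hp => ?_)
  exact Or.inl (div_pos hp hZ).ne'

namespace IsBowlSlope

variable {N : ℝ} {y y' : ℝ → ℝ}

theorem flux_barrier (H : IsBowlSlope N y y') {Z κ lam z : ℝ} (hZ : 0 < Z) (hlam : 0 < lam)
    (hz : 0 < z) : flux (N - 1) (fun t => y (barrierArg Z κ lam t)) z =
      barrierArg Z κ lam z / z * (1 + κ * bend y y' (barrierArg Z κ lam z)) := by
  have hw := barrierArg_pos (κ := κ) hZ hlam hz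
  have hd : HasDerivAt (fun t => y (barrierArg Z κ lam t)) _ z :=
    (H.hasDerivAt _).comp z (hasDerivAt_barrierArg hZ hz)
  rw [flux, hd.deriv, H.mul_eq hw, H.deriv_eq]
  field_simp
  ring

theorem hasDerivAt_flux_barrier (H : IsBowlSlope N y y') {Z κ lam z : ℝ} (hZ : 0 < Z)
    (hlam : 0 < lam) (hz : 0 < z) :
    HasDerivAt (flux (N - 1) fun t => y (barrierArg Z κ lam t))
      (κ * (barrierArg Z κ lam z / z ^ 2 * (1 + κ * bend y y' (barrierArg Z κ lam z) -
        (1 + κ) * bendDecay N y y' (barrierArg Z κ lam z)))) z := by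
  have hw := barrierArg_pos (κ := κ) hZ hlam hz
  have hd := hasDerivAt_barrierArg (κ := κ) (lam := lam) hZ hz
  have hb := (H.hasDerivAt_bend hw).comp z hd
  have h := (hd.div (hasDerivAt_id z) hz.ne').mul ((hb.const_mul κ).const_add 1)
  have heq : (flux (N - 1) fun t => y (barrierArg Z κ lam t)) =ᶠ[𝓝 z] fun t =>
      barrierArg Z κ lam t / t * (1 + κ * bend y y' (barrierArg Z κ lam t)) := by
    filter_upwards [lt_mem_nhds hz] with t ht using H.flux_barrier hZ hlam ht
  refine (h.congr_of_eventuallyEq heq).congr_deriv ?_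
  simp only [id, Function.comp_apply, Pi.div_apply]
  field_simp
  ring

theorem exists_barrier_rate (H : IsBowlSlope N y y') {W Z : ℝ} (hW : 0 < W) (hZ : 0 < Z) :
    ∃ k₀ > 0, ∃ r > 0, ∀ κ, |κ| < k₀ → ∀ w ∈ Ioc 0 W,
      y' w * r * Z ^ 2 < 1 + κ * bend y y' w - (1 + κ) * bendDecay N y y' w := by
  have hN := H.two_le
  obtain ⟨w₀, hw₀, hmin⟩ := isCompact_Icc.exists_isMinOn (nonempty_Icc.mpr hW.le)
    H.continuous_bend.continuousOn
  obtain ⟨w₁, hw₁, hmax⟩ := isCompact_Icc.exists_isMaxOn (nonempty_Icc.mpr hW.le)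
    H.continuous_deriv.continuousOn
  set b := bend y y' w₀ with hb
  have hbpos : 0 < b := H.bend_pos hw₀.1
  have hCpos : 0 < y' w₁ := by
    rw [H.deriv_eq]
    exact mul_pos (by positivity) (H.bend_pos hw₁.1)
  refine ⟨b ^ 2, by positivity, b ^ 2 / (y' w₁ * Z ^ 2), by positivity, fun κ hκ w hw => ?_⟩
  have h1 : y' w * (b ^ 2 / (y' w₁ * Z ^ 2)) * Z ^ 2 ≤ b ^ 2 := by
    have : y' w ≤ y' w₁ := hmax (Ioc_subset_Icc_self hw)
    calc y' w * (b ^ 2 / (y' w₁ * Z ^ 2)) * Z ^ 2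
        ≤ y' w₁ * (b ^ 2 / (y' w₁ * Z ^ 2)) * Z ^ 2 := by gcongr
      _ = b ^ 2 := by field_simp
  have h2 : b ≤ bend y y' w := hmin (Ioc_subset_Icc_self hw)
  have h3 := H.bendDecay_lt hw.1.le
  have h4 : (2 * b) ^ 2 ≤ (N * bend y y' w) ^ 2 := by gcongr
  have h5 : |bend y y' w - bendDecay N y y' w| ≤ 1 := by
    have h6 : 0 ≤ (N - 1) * (1 + y w ^ 2) * bend y y' w :=
      mul_nonneg (mul_nonneg (by linarith) (by positivity)) (hbpos.le.trans h2)
    refine abs_le.mpr ⟨?_, ?_⟩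
    · linarith [sq_nonneg (N * bend y y' w)]
    · rw [bendDecay]
      linarith
  have h7 : |κ * (bend y y' w - bendDecay N y y' w)| < b ^ 2 := by
    rw [abs_mul]
    exact (mul_le_of_le_one_right (abs_nonneg _) h5).trans_lt hκ
  have h8 := (abs_lt.mp h7).1
  have h9 : 0 < b ^ 2 := by positivity
  linarith

end IsBowlSlope

theorem barrierArg_le {Z κ lam z : ℝ} (hlam : 0 ≤ lam) (hz : 0 < z) (hzZ : z ≤ Z) (hκ : -1 ≤ κ) :
    barrierArg Z κ lam z ≤ lam * Z := by
  have hZ := hz.trans_le hzZ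
  have h1 : barrierArg Z κ lam z = lam * Z * (z / Z) ^ (κ + 1) := by
    rw [Real.rpow_add_one (by positivity), barrierArg]
    field_simp
  rw [h1]
  exact mul_le_of_le_one_right (by positivity)
    (Real.rpow_le_one (by positivity) ((div_le_one hZ).mpr hzZ) (by linarith))

theorem mul_le_barrierArg {Z κ lam z : ℝ} (hlam : 0 ≤ lam) (hz : 0 < z) (hzZ : z ≤ Z)
    (hκ : κ ≤ 0) : lam * z ≤ barrierArg Z κ lam z := by
  have hZ := hz.trans_le hzZ
  exact le_mul_of_one_le_right (by positivity)
    (Real.one_le_rpow_of_pos_of_le_one_of_nonpos (by positivity) ((div_le_one hZ).mpr hzZ) hκ)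

theorem barrierArg_le_mul {Z κ lam z : ℝ} (hlam : 0 ≤ lam) (hz : 0 < z) (hzZ : z ≤ Z)
    (hκ : 0 ≤ κ) : barrierArg Z κ lam z ≤ lam * z := by
  have hZ := hz.trans_le hzZ
  exact mul_le_of_le_one_right (by positivity)
    (Real.rpow_le_one (by positivity) ((div_le_one hZ).mpr hzZ) hκ)

theorem barrierArg_mono {Z κ lam lam' z : ℝ} (hZ : 0 < Z) (hz : 0 < z) (h : lam ≤ lam') :
    barrierArg Z κ lam z ≤ barrierArg Z κ lam' z := by
  unfold barrierArg
  gcongr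

theorem barrierParam_mem_Icc {lam ρ s₁ s₀ s t : ℝ} (hlam : 0 < lam) (hs : s ∈ Icc s₀ t) :
    barrierParam lam ρ s₁ s ∈
      uIcc (barrierParam lam ρ s₁ s₀) (barrierParam lam ρ s₁ t) := by
  rcases le_total 0 ρ with hρ | hρ
  · refine Icc_subset_uIcc ⟨?_, ?_⟩ <;> unfold barrierParam <;> gcongr
    exacts [hs.1, hs.2]
  · refine Icc_subset_uIcc' ⟨?_, ?_⟩ <;> unfold barrierParam <;> gcongr 2 <;>
      refine mul_le_mul_of_nonpos_left ?_ hρ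
    exacts [sub_le_sub_right hs.2 _, sub_le_sub_right hs.1 _]

theorem eventually_mul_rpow_lt {Z k c d : ℝ} (hk : 0 < k) (hd : 0 < d) :
    ∀ᶠ δ in 𝓝[>] 0, c * (δ / Z) ^ k < d := by
  have h : Tendsto (fun δ : ℝ => c * (δ / Z) ^ k) (𝓝 0) (𝓝 (c * (0 / Z) ^ k)) :=
    (((continuous_id.div_const Z).rpow_const fun _ => Or.inr hk.le).const_mul c).tendsto 0
  rw [zero_div, Real.zero_rpow hk.ne', mul_zero] at h
  exact (h.mono_left nhdsWithin_le_nhds).eventually_lt_const hd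

namespace IsBowlSlope

variable {N : ℝ} {y y' : ℝ → ℝ}

theorem barrier_defect (H : IsBowlSlope N y y') {Z κ r lam s₁ s z : ℝ} (hlam : 0 < lam)
    (hr : 0 < r) (hz : 0 < z) (hzZ : z ≤ Z)
    (hrate : ∀ w, w = barrierArg Z κ (barrierParam lam (κ * r) s₁ s) z →
      y' w * r * Z ^ 2 < 1 + κ * bend y y' w - (1 + κ) * bendDecay N y y' w) :
    ∃ vs Fv e, 0 < e ∧
      HasDerivAt (fun t => y (barrierArg Z κ (barrierParam lam (κ * r) s₁ t) z)) vs s ∧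
      HasDerivAt (flux (N - 1) fun x => y (barrierArg Z κ (barrierParam lam (κ * r) s₁ s) x))
        Fv z ∧ vs - Fv = -(κ * e) := by
  have hZ := hz.trans_le hzZ
  have hlam' := barrierParam_pos hlam (κ * r) s₁ s
  have hw := barrierArg_pos (κ := κ) hZ hlam' hz
  have hy' : 0 < y' (barrierArg Z κ (barrierParam lam (κ * r) s₁ s) z) := by
    rw [H.deriv_eq]
    exact mul_pos (by positivity) (H.bend_pos hw.le)
  have h2 := hrate _ rfl
  refine ⟨_, _, barrierArg Z κ (barrierParam lam (κ * r) s₁ s) z / z ^ 2 *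
    (1 + κ * bend y y' (barrierArg Z κ (barrierParam lam (κ * r) s₁ s) z) -
      (1 + κ) * bendDecay N y y' (barrierArg Z κ (barrierParam lam (κ * r) s₁ s) z) -
      y' (barrierArg Z κ (barrierParam lam (κ * r) s₁ s) z) * r * z ^ 2), ?_,
    (H.hasDerivAt _).comp s (hasDerivAt_barrierArg_param Z κ lam (κ * r) s₁ z s),
    H.hasDerivAt_flux_barrier hZ hlam' hz, ?_⟩
  · generalize barrierArg Z κ (barrierParam lam (κ * r) s₁ s) z = w at *
    have h3 : y' w * r * z ^ 2 ≤ y' w * r * Z ^ 2 := by gcongr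
    exact mul_pos (by positivity) (by linarith)
  · generalize barrierArg Z κ (barrierParam lam (κ * r) s₁ s) z = w at *
    field_simp
    ring

theorem continuousOn_barrier (H : IsBowlSlope N y y') {δ Z : ℝ} (hδ : 0 < δ) (hZ : 0 < Z)
    (κ lam ρ s₁ s₀ : ℝ) :
    ContinuousOn (Function.uncurry fun z s => y (barrierArg Z κ (barrierParam lam ρ s₁ s) z))
      (Icc δ Z ×ˢ Icc s₀ s₁) :=
  H.continuous.comp_continuousOn
    ((continuousOn_barrierArg hZ κ lam ρ s₁).mono fun _ hp => hδ.trans_le hp.1.1)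

theorem differentiableAt_barrier (H : IsBowlSlope N y y') {Z κ lam z : ℝ} (hZ : 0 < Z)
    (hz : 0 < z) : DifferentiableAt ℝ (fun x => y (barrierArg Z κ lam x)) z :=
  ((H.hasDerivAt _).comp z (hasDerivAt_barrierArg hZ hz)).differentiableAt

/-- A solution below the soliton at `z = Z` for all times lies below every upper barrier. -/
theorem lt_upper_barrier (H : IsBowlSlope N y y') {q : ℝ → ℝ → ℝ}
    (hq : IsFluxSolution (N - 1) q) {c lam Z : ℝ} (hc : 0 ≤ c) (hlam : 0 < lam) (hZ : 0 < Z)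
    (hub : ∀ z s, 0 < z → q z s ≤ c * z) (hright : ∀ s, q Z s < y (lam * Z)) :
    ∃ k₀ > 0, ∀ k ∈ Ioo 0 k₀, ∀ z ∈ Ioc 0 Z, ∀ s, q z s < y (barrierArg Z (-k) lam z) := by
  have hN := H.two_le
  obtain ⟨k₀, hk₀, r, hr, hrate⟩ :=
    H.exists_barrier_rate (W := (lam + (N * c + 1)) * Z) (Z := Z) (by positivity) hZ
  refine ⟨min k₀ 1, lt_min hk₀ one_pos, fun k hk z hz s₁ => ?_⟩
  have hk0 := hk.1
  have hkk₀ := hk.2.trans_le (min_le_left _ _)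
  have hk1 := hk.2.trans_le (min_le_right _ _)
  set ρ := -k * r with hρdef
  have hρ : ρ < 0 := mul_neg_of_neg_of_pos (by linarith) hr
  set Λ := lam + (N * c + 1) with hΛ
  have hlamΛ : lam ≤ Λ := by rw [hΛ]; linarith [show 0 ≤ N * c by positivity]
  have hΛpos : 0 < Λ := hlam.trans_le hlamΛ
  set s₀ := s₁ + Real.log (Λ / lam) / ρ with hs₀
  have hstart : barrierParam lam ρ s₁ s₀ = Λ := barrierParam_start hlam hΛpos hρ.ne s₁
  have hs₀₁ : s₀ ≤ s₁ :=
    add_le_of_nonpos_right (div_nonpos_of_nonneg_of_nonpos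
      (Real.log_nonneg ((one_le_div hlam).mpr hlamΛ)) hρ.le)
  have hparam : ∀ s ∈ Icc s₀ s₁, barrierParam lam ρ s₁ s ∈ Icc lam Λ := by
    intro s hs
    have := barrierParam_mem_Icc (ρ := ρ) (s₁ := s₁) hlam hs
    rwa [hstart, barrierParam_self, uIcc_of_ge hlamΛ] at this
  obtain ⟨δ, ⟨hδsmall, hδz⟩, hδ⟩ := ((eventually_mul_rpow_lt (c := N * c) hk0 hlam).and
    (Ioc_mem_nhdsGT hz.1)).and self_mem_nhdsWithin |>.exists
  replace hδ : 0 < δ := hδ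
  have key := lt_of_strict_supersolution (m := N - 1) (Z := Z) (s₀ := s₀) (s₁ := s₁) hδ (u := q)
    (v := fun z s => y (barrierArg Z (-k) (barrierParam lam ρ s₁ s) z))
    (hq.continuousOn.mono fun p hp => hδ.trans_le hp.1.1)
    (H.continuousOn_barrier hδ hZ _ _ _ _ _) ?_ ?_ ?_
    (fun s x hx => hq.differentiableAt x s (hδ.trans hx.1))
    (fun s x hx => H.differentiableAt_barrier hZ (hδ.trans hx.1)) ?_ z
    ⟨hδz.2, hz.2⟩ s₁ ⟨hs₀₁, le_rfl⟩
  · simpa only [barrierParam_self] using key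
  · intro x hx
    have hx0 := hδ.trans_le hx.1
    have h1 := mul_le_barrierArg (κ := -k) hΛpos.le hx0 hx.2 (by linarith)
    have h2 := H.div_le_slope (barrierArg_pos (κ := -k) hZ hΛpos hx0)
    rw [hstart]
    refine lt_of_lt_of_le ?_ h2
    rw [lt_div_iff₀ (by linarith)]
    have h3 := hub x s₀ hx0
    calc q x s₀ * N ≤ c * x * N := by gcongr
      _ < c * x * N + (lam + 1) * x := lt_add_of_pos_right _ (by positivity)
      _ = Λ * x := by rw [hΛ]; ring
      _ ≤ _ := h1
  · intro s hs
    have h1 := barrierArg_mono (κ := -k) hZ hδ (hparam s hs).1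
    have h2 := H.div_le_slope (barrierArg_pos (κ := -k) hZ (barrierParam_pos hlam ρ s₁ s) hδ)
    refine (hub δ s hδ).trans_lt (lt_of_lt_of_le ?_ h2)
    rw [lt_div_iff₀ (by linarith)]
    refine lt_of_lt_of_le ?_ h1
    rw [barrierArg, Real.rpow_neg (by positivity), ← div_eq_mul_inv,
      lt_div_iff₀ (by positivity)]
    calc c * δ * N * (δ / Z) ^ k = δ * (N * c * (δ / Z) ^ k) := by ring
      _ < δ * lam := by gcongr
      _ = lam * δ := mul_comm _ _
  · intro s hs
    have h1 := barrierArg_self hZ (-k) (barrierParam lam ρ s₁ s)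
    have hmono : lam * Z ≤ barrierParam lam ρ s₁ s * Z := by
      gcongr
      exact (hparam s hs).1
    show q Z s < y (barrierArg Z (-k) (barrierParam lam ρ s₁ s) Z)
    rw [h1]
    exact (hright s).trans_le (H.monotoneOn (mem_Ici.mpr (by positivity))
      (mem_Ici.mpr ((mul_pos hlam hZ).le.trans hmono)) hmono)
  · intro x hx s hs
    have hx0 := hδ.trans hx.1
    have hp := hparam s (Ioc_subset_Icc_self hs)
    have hppos := barrierParam_pos hlam ρ s₁ s
    obtain ⟨d, hd1, hd2⟩ := hq.hasDerivAt x s hx0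
    obtain ⟨vs, Fv, e, he, hvs, hFv, hdef⟩ := H.barrier_defect (κ := -k) (s₁ := s₁) (s := s) hlam hr
      hx0 hx.2.le (fun w hw => hrate (-k) (by rwa [abs_neg, abs_of_pos hk0]) w (by
        rw [hw]
        refine ⟨barrierArg_pos hZ hppos hx0,
          (barrierArg_le hppos.le hx0 hx.2.le (by linarith)).trans ?_⟩
        gcongr
        exact hp.2))
    refine ⟨d, vs, d, Fv, hd1, hvs, hd2, hFv, ?_⟩
    rw [hdef, sub_self, neg_mul, neg_neg]
    positivity

/-- A solution above the soliton at `z = Z` for all times lies above every lower barrier. -/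
theorem lower_barrier_lt (H : IsBowlSlope N y y') {q : ℝ → ℝ → ℝ}
    (hq : IsFluxSolution (N - 1) q) {c lam Z : ℝ} (hc : 0 < c) (hlam : 0 < lam) (hZ : 0 < Z)
    (hlb : ∀ z s, 0 < z → c * z ≤ q z s) (hright : ∀ s, y (lam * Z) < q Z s) :
    ∃ k₀ > 0, ∀ k ∈ Ioo 0 k₀, ∀ z ∈ Ioc 0 Z, ∀ s, y (barrierArg Z k lam z) < q z s := by
  have hN := H.two_le
  have hN1 : 0 < N - 1 := by linarith
  obtain ⟨k₀, hk₀, r, hr, hrate⟩ :=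
    H.exists_barrier_rate (W := lam * Z) (Z := Z) (by positivity) hZ
  refine ⟨k₀, hk₀, fun k hk z hz s₁ => ?_⟩
  have hk0 := hk.1
  set ρ := k * r with hρdef
  have hρ : 0 < ρ := mul_pos hk0 hr
  obtain ⟨Λ, hΛpos, hΛ⟩ := exists_between (lt_min hlam (mul_pos hc hN1))
  have hΛlam : Λ ≤ lam := (hΛ.trans_le (min_le_left _ _)).le
  have hΛc : Λ < c * (N - 1) := hΛ.trans_le (min_le_right _ _)
  set s₀ := s₁ + Real.log (Λ / lam) / ρ with hs₀
  have hstart : barrierParam lam ρ s₁ s₀ = Λ := barrierParam_start hlam hΛpos hρ.ne' s₁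
  have hs₀₁ : s₀ ≤ s₁ :=
    add_le_of_nonpos_right (div_nonpos_of_nonpos_of_nonneg
      (Real.log_nonpos (by positivity) ((div_le_one hlam).mpr hΛlam)) hρ.le)
  have hparam : ∀ s ∈ Icc s₀ s₁, barrierParam lam ρ s₁ s ∈ Icc Λ lam := by
    intro s hs
    have := barrierParam_mem_Icc (ρ := ρ) (s₁ := s₁) hlam hs
    rwa [hstart, barrierParam_self, uIcc_of_le hΛlam] at this
  obtain ⟨δ, ⟨hδsmall, hδz⟩, hδ⟩ := ((eventually_mul_rpow_lt (c := lam) hk0 (mul_pos hc hN1)).and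
    (Ioc_mem_nhdsGT hz.1)).and self_mem_nhdsWithin |>.exists
  replace hδ : 0 < δ := hδ
  have key := lt_of_strict_supersolution (m := N - 1) (Z := Z) (s₀ := s₀) (s₁ := s₁) hδ (v := q)
    (u := fun z s => y (barrierArg Z k (barrierParam lam ρ s₁ s) z))
    (H.continuousOn_barrier hδ hZ _ _ _ _ _)
    (hq.continuousOn.mono fun p hp => hδ.trans_le hp.1.1) ?_ ?_ ?_
    (fun s x hx => H.differentiableAt_barrier hZ (hδ.trans hx.1))
    (fun s x hx => hq.differentiableAt x s (hδ.trans hx.1)) ?_ z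
    ⟨hδz.2, hz.2⟩ s₁ ⟨hs₀₁, le_rfl⟩
  · simpa only [barrierParam_self] using key
  · intro x hx
    have hx0 := hδ.trans_le hx.1
    have h1 := barrierArg_le_mul (κ := k) hΛpos.le hx0 hx.2 hk0.le
    have h2 := H.slope_le_div (barrierArg_pos (κ := k) hZ hΛpos hx0)
    rw [hstart]
    refine h2.trans_lt ?_
    rw [div_lt_iff₀ hN1]
    have h3 := hlb x s₀ hx0
    calc barrierArg Z k Λ x ≤ Λ * x := h1
      _ < c * (N - 1) * x := by gcongr
      _ = c * x * (N - 1) := by ring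
      _ ≤ q x s₀ * (N - 1) := by gcongr
  · intro s hs
    have h1 := barrierArg_mono (κ := k) hZ hδ (hparam s hs).2
    have h2 := H.slope_le_div (barrierArg_pos (κ := k) hZ (barrierParam_pos hlam ρ s₁ s) hδ)
    refine (h2.trans_lt ?_).trans_le (hlb δ s hδ)
    rw [div_lt_iff₀ hN1]
    calc barrierArg Z k (barrierParam lam ρ s₁ s) δ ≤ barrierArg Z k lam δ := h1
      _ = δ * (lam * (δ / Z) ^ k) := by rw [barrierArg]; ring
      _ < δ * (c * (N - 1)) := by gcongr
      _ = c * δ * (N - 1) := by ring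
  · intro s hs
    have h1 := barrierArg_self hZ k (barrierParam lam ρ s₁ s)
    have hmono : barrierParam lam ρ s₁ s * Z ≤ lam * Z := by
      gcongr
      exact (hparam s hs).2
    have hppos := barrierParam_pos hlam ρ s₁ s
    show y (barrierArg Z k (barrierParam lam ρ s₁ s) Z) < q Z s
    rw [h1]
    exact (H.monotoneOn (mem_Ici.mpr (by positivity)) (mem_Ici.mpr (by positivity)) hmono).trans_lt
      (hright s)
  · intro x hx s hs
    have hx0 := hδ.trans hx.1
    have hp := hparam s (Ioc_subset_Icc_self hs)
    have hppos := barrierParam_pos hlam ρ s₁ s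
    obtain ⟨d, hd1, hd2⟩ := hq.hasDerivAt x s hx0
    obtain ⟨vs, Fv, e, he, hvs, hFv, hdef⟩ := H.barrier_defect (κ := k) (s₁ := s₁) (s := s) hlam hr
      hx0 hx.2.le (fun w hw => hrate k (by rw [abs_of_pos hk0]; exact hk.2) w (by
        rw [hw]
        refine ⟨barrierArg_pos hZ hppos hx0,
          (barrierArg_le hppos.le hx0 hx.2.le (by linarith)).trans ?_⟩
        gcongr
        exact hp.2))
    refine ⟨vs, d, Fv, d, hvs, hd1, hFv, hd2, ?_⟩
    rw [hdef, sub_self, neg_lt_zero]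
    positivity

theorem barrier_tendsto (H : IsBowlSlope N y y') {Z lam z : ℝ} (hZ : 0 < Z) (hz : 0 < z)
    {l : Filter ℝ} {κ : ℝ → ℝ} (hκ : Tendsto κ l (𝓝 0)) :
    Tendsto (fun k => y (barrierArg Z (κ k) lam z)) l (𝓝 (y (lam * z))) := by
  have h : Tendsto (fun k => barrierArg Z (κ k) lam z) l (𝓝 (lam * z * (z / Z) ^ (0 : ℝ))) :=
    (tendsto_const_nhds.rpow hκ (Or.inl (by positivity))).const_mul (lam * z)
  rw [Real.rpow_zero, mul_one] at h
  exact (H.continuous.tendsto _).comp h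

theorem le_soliton (H : IsBowlSlope N y y') {q : ℝ → ℝ → ℝ}
    (hq : IsFluxSolution (N - 1) q) {c lam Z z : ℝ} (hc : 0 ≤ c) (hlam : 0 < lam) (hz : 0 < z)
    (hzZ : z ≤ Z) (hub : ∀ z s, 0 < z → q z s ≤ c * z) (hright : ∀ s, q Z s < y (lam * Z)) (s : ℝ) :
    q z s ≤ y (lam * z) := by
  have hZ := hz.trans_le hzZ
  obtain ⟨k₀, hk₀, h⟩ := H.lt_upper_barrier hq hc hlam hZ hub hright
  have hlim : Tendsto (fun k : ℝ => -k) (𝓝[>] 0) (𝓝 0) := by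
    have : Tendsto (fun k : ℝ => -k) (𝓝 0) (𝓝 (-0)) := tendsto_id.neg
    rw [neg_zero] at this
    exact this.mono_left nhdsWithin_le_nhds
  refine ge_of_tendsto (H.barrier_tendsto hZ hz hlim) ?_
  filter_upwards [Ioo_mem_nhdsGT hk₀] with k hk using (h k hk z ⟨hz, hzZ⟩ s).le

theorem soliton_le (H : IsBowlSlope N y y') {q : ℝ → ℝ → ℝ}
    (hq : IsFluxSolution (N - 1) q) {c lam Z z : ℝ} (hc : 0 < c) (hlam : 0 < lam) (hz : 0 < z)
    (hzZ : z ≤ Z) (hlb : ∀ z s, 0 < z → c * z ≤ q z s) (hright : ∀ s, y (lam * Z) < q Z s) (s : ℝ) :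
    y (lam * z) ≤ q z s := by
  have hZ := hz.trans_le hzZ
  obtain ⟨k₀, hk₀, h⟩ := H.lower_barrier_lt hq hc hlam hZ hlb hright
  have hlim : Tendsto (fun k : ℝ => k) (𝓝[>] 0) (𝓝 0) := tendsto_id.mono_left nhdsWithin_le_nhds
  refine le_of_tendsto (H.barrier_tendsto hZ hz hlim) ?_
  filter_upwards [Ioo_mem_nhdsGT hk₀] with k hk using (h k hk z ⟨hz, hzZ⟩ s).le

/-- The slopes of the rescaled solitons are asymptotic to `lam / (N - 1) * z`. -/
theorem slope_scaled_tendsto (H : IsBowlSlope N y y') {lam : ℝ} (hlam : 0 < lam) :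
    Tendsto (fun z => y (lam * z) / z) atTop (𝓝 (lam / (N - 1))) := by
  have h := (H.slope_div_tendsto.comp (tendsto_id.const_mul_atTop hlam)).const_mul lam
  rw [mul_one_div] at h
  refine h.congr fun z => ?_
  simp only [Function.comp_apply, id]
  rw [← mul_div_assoc, mul_div_mul_left _ _ hlam.ne']

theorem eq_soliton (H : IsBowlSlope N y y') {q : ℝ → ℝ → ℝ}
    (hq : IsFluxSolution (N - 1) q) {cm cp a : ℝ} (hcm : 0 < cm) (hcp : 0 ≤ cp) (ha : 0 < a)
    (hlb : ∀ z s, 0 < z → cm * z ≤ q z s) (hub : ∀ z s, 0 < z → q z s ≤ cp * z)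
    (hconv : ∀ ε > 0, ∃ Z, ∀ z s, Z ≤ z → |q z s / z - a / (N - 1)| ≤ ε)
    {z : ℝ} (hz : 0 < z) (s : ℝ) : q z s = y (a * z) := by
  have hN1 : 0 < N - 1 := by linarith [H.two_le]
  have hcont : Tendsto (fun lam => y (lam * z)) (𝓝 a) (𝓝 (y (a * z))) :=
    (H.continuous.comp (continuous_mul_const z)).tendsto a
  apply le_antisymm
  · refine ge_of_tendsto (hcont.mono_left (nhdsWithin_le_nhds (s := Ioi a))) ?_
    filter_upwards [self_mem_nhdsWithin] with lam hlam
    simp only [mem_Ioi] at hlam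
    obtain ⟨b, hab, hbl⟩ := exists_between (div_lt_div_of_pos_right hlam hN1)
    obtain ⟨Z₀, hZ₀⟩ := hconv _ (sub_pos.mpr hab)
    have hlam0 := ha.trans hlam
    obtain ⟨Z, ⟨hbZ, hzZ⟩, hZZ⟩ := (((H.slope_scaled_tendsto hlam0).eventually_const_lt hbl).and
      (eventually_ge_atTop z)).and (eventually_ge_atTop Z₀) |>.exists
    have hZ := hz.trans_le hzZ
    refine H.le_soliton hq hcp hlam0 hz hzZ hub (fun t => ?_) s
    have := (abs_le.mp (hZ₀ Z t hZZ)).2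
    exact (div_lt_div_iff_of_pos_right hZ).mp (by linarith)
  · refine le_of_tendsto (hcont.mono_left (nhdsWithin_le_nhds (s := Iio a))) ?_
    filter_upwards [Ioo_mem_nhdsLT ha] with lam hlam
    obtain ⟨b, hlb', hba⟩ := exists_between (div_lt_div_of_pos_right hlam.2 hN1)
    obtain ⟨Z₀, hZ₀⟩ := hconv _ (sub_pos.mpr hba)
    obtain ⟨Z, ⟨hbZ, hzZ⟩, hZZ⟩ := (((H.slope_scaled_tendsto hlam.1).eventually_lt_const hlb').and
      (eventually_ge_atTop z)).and (eventually_ge_atTop Z₀) |>.exists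
    have hZ := hz.trans_le hzZ
    refine H.soliton_le hq hcm hlam.1 hz hzZ hlb (fun t => ?_) s
    have := (abs_le.mp (hZ₀ Z t hZZ)).1
    exact (div_lt_div_iff_of_pos_right hZ).mp (by linarith)

end IsBowlSlope

theorem isFluxSolution_of_contDiffOn {m : ℝ} {q : ℝ → ℝ → ℝ}
    (hq : ContDiffOn ℝ (⊤ : ℕ∞) (Function.uncurry q) {p : ℝ × ℝ | 0 < p.1})
    (hPDE : ∀ z s : ℝ, 0 < z →
      deriv (fun s' => q z s') s = deriv (flux m fun z' => q z' s) z) :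
    IsFluxSolution m q := by
  have hopen : IsOpen {p : ℝ × ℝ | 0 < p.1} := isOpen_lt continuous_const continuous_fst
  have hslice : ∀ s, ContDiffOn ℝ (⊤ : ℕ∞) (fun z => q z s) (Ioi 0) := fun s =>
    hq.comp (contDiff_id.prodMk contDiff_const).contDiffOn fun z hz => hz
  have hdiff : ∀ z s, 0 < z → DifferentiableAt ℝ (fun z' => q z' s) z := fun z s hz =>
    ((hslice s).contDiffAt (Ioi_mem_nhds hz)).differentiableAt (by simp)
  refine ⟨hq.continuousOn, hdiff, fun z s hz => ⟨deriv (fun s' => q z s') s, ?_, ?_⟩⟩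
  · have h1 : DifferentiableAt ℝ (Function.uncurry q) (z, s) :=
      (hq.contDiffAt (hopen.mem_nhds hz)).differentiableAt (by simp)
    have h2 : DifferentiableAt ℝ (fun s' => (z, s')) s := by fun_prop
    exact (h1.comp s h2).hasDerivAt
  · rw [hPDE z s hz]
    have h1 : DifferentiableAt ℝ (deriv fun z' => q z' s) z :=
      (((hslice s).deriv_of_isOpen (m := (⊤ : ℕ∞)) isOpen_Ioi
        (by simp)).contDiffAt (Ioi_mem_nhds hz)).differentiableAt (by simp)
    have h2 := hdiff z s hz
    refine DifferentiableAt.hasDerivAt (DifferentiableAt.add (h1.div ?_ ?_) ?_)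
    · fun_prop
    · positivity
    · exact (h2.const_mul m).div differentiableAt_id hz.ne'

/-- Rigidity of the eternal limit solution in the Type-II blow-up lemma:
a smooth eternal solution `q(z,s)` of `∂_s q = ∂_z(q_z/(1+q²) + (n−1)q/z)` on
`(0,∞) × ℝ` which is pinched between two linear functions `c⁻z ≤ q ≤ c⁺z` and satisfies
`q(z,s)/z → a/(n−1)` as `z → ∞` uniformly in `s` must be the bowl soliton equilibrium
`q(z,s) = P'(az)`, where `P` is the bowl soliton profile. -/
theorem eternal_solution_rigidity
    (n : ℕ) (hn : 2 ≤ n) (a : ℝ) (ha : 0 < a)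
    (P : ℝ → ℝ) (hP : ContDiff ℝ 2 P) (hP0 : P 0 = 0) (hP0' : deriv P 0 = 0)
    (hPode : ∀ w : ℝ, 0 < w →
      deriv (deriv P) w / (1 + (deriv P w) ^ 2) + ((n : ℝ) - 1) * deriv P w / w = 1)
    (q : ℝ → ℝ → ℝ)
    (hq : ContDiffOn ℝ (⊤ : ℕ∞) (Function.uncurry q) {p : ℝ × ℝ | 0 < p.1})
    (hPDE : ∀ z s : ℝ, 0 < z →
      deriv (fun s' => q z s') s =
        deriv (fun z' => deriv (fun z'' => q z'' s) z' / (1 + (q z' s) ^ 2)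
          + ((n : ℝ) - 1) * q z' s / z') z)
    (cm cp : ℝ) (hcm : 0 < cm) (hcmp : cm ≤ cp)
    (hpinch : ∀ z s : ℝ, 0 < z → cm * z ≤ q z s ∧ q z s ≤ cp * z)
    (hconv : ∀ ε : ℝ, 0 < ε → ∃ Z : ℝ, ∀ z s : ℝ, Z ≤ z →
      |q z s / z - a / ((n : ℝ) - 1)| ≤ ε) :
    ∀ z s : ℝ, 0 < z → q z s = deriv P (a * z) := by
  have hy : ContDiff ℝ 1 (deriv P) := ((contDiff_succ_iff_deriv (n := 1)).mp hP).2.2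
  have H : IsBowlSlope n (deriv P) (deriv (deriv P)) :=
    { two_le := by exact_mod_cast hn
      continuous_deriv := hy.continuous_deriv le_rfl
      hasDerivAt := fun w => (hy.differentiable (by simp) w).hasDerivAt
      map_zero := hP0'
      ode := hPode }
  exact fun z s hz => H.eq_soliton (isFluxSolution_of_contDiffOn hq hPDE) hcm
    (hcm.le.trans hcmp) ha (fun z s hz => (hpinch z s hz).1) (fun z s hz => (hpinch z s hz).2)
    hconv hz s
end
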